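/- arXiv:2407.18260 — 2 statements merged into one kernel-verified Lean document; each statement's English description precedes it below -/
import Mathlib

section
/- Let G be a finite group and p a prime. Suppose the p-Sylow subgroup N of G is normal and cyclic, and that 𝒮_{G/N} ⊆ 𝒫_{G/N}. Then 𝒮_G ⊆ 𝒫_G. -/
open scoped Classical

noncomputable section

/-- The complex conjugate of a complex-valued function. -/
def conjFun {G : Type} (f : G → ℂ) : G → ℂ := fun g => starRingEnd ℂ (f g)

/-- Induction of class functions from a subgroup `H` of `G` to `G`. -/
def indChar {G : Type} [Group G] [Fintype G] (H : Subgroup G) (f : ↥H → ℂ) : G → ℂ :=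
  fun g => (Nat.card H : ℂ)⁻¹ *
    ∑ x : G, if h : x⁻¹ * g * x ∈ H then f ⟨x⁻¹ * g * x, h⟩ else 0

/-- The determinant (linear) character of a finite-dimensional complex representation. -/
def detRep {G : Type} [Group G] (V : FDRep ℂ G) : G → ℂ := fun g => LinearMap.det (V.ρ g)

/-- `f` is the character of some finite-dimensional complex representation of `G`. -/
def IsChar {G : Type} [Group G] (f : G → ℂ) : Prop := ∃ V : FDRep ℂ G, V.character = f

/-- A generalised (virtual) character: a `ℤ`-linear combination of characters. -/
def IsGenChar {G : Type} [Group G] (f : G → ℂ) : Prop :=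
  f ∈ Submodule.span ℤ {f : G → ℂ | IsChar f}

/-- A generalised character has trivial determinant: writing `f = χ_V - χ_W`,
`det V ⊗ conj (det W)` is the trivial character. -/
def HasTrivialDet {G : Type} [Group G] (f : G → ℂ) : Prop :=
  ∃ V W : FDRep ℂ G, f = V.character - W.character ∧
    ∀ g, detRep V g * starRingEnd ℂ (detRep W g) = 1

/-- A permutation character: a `ℤ`-linear combination of characters `Ind_H^G 1_H`. -/
def IsPermChar {G : Type} [Group G] [Fintype G] (f : G → ℂ) : Prop :=
  f ∈ Submodule.span ℤ {f : G → ℂ | ∃ H : Subgroup G, f = indChar H 1}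

/-- `𝒮_G`: permutation characters of `G` of degree `0` and trivial determinant. -/
def SG (G : Type) [Group G] [Fintype G] : Set (G → ℂ) :=
  {f | IsPermChar f ∧ f 1 = 0 ∧ HasTrivialDet f}

/-- `Q` is isomorphic to `C₂ × C₂`, to `D₈`, or to `D_{2p}` for an odd prime `p`
(`DihedralGroup m` is the dihedral group of order `2m`). -/
def IsTargetGroup (Q : Type) [Group Q] : Prop :=
  Nonempty (Q ≃* Multiplicative (ZMod 2 × ZMod 2)) ∨ Nonempty (Q ≃* DihedralGroup 4) ∨
    ∃ p : ℕ, Odd p ∧ p.Prime ∧ Nonempty (Q ≃* DihedralGroup p)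

/-- `𝒫_G`: the smallest set of generalised characters of `G` containing `τ + τ̄` for every
generalised character `τ` of degree 0, containing `Ind_H^G (τ - 1 - det τ)` for every degree-2
character `τ` of a subgroup `H` factoring through a quotient of `H` isomorphic to `C₂ × C₂`,
`D₈` or `D_{2p}` (`p` an odd prime), and closed under `ℤ`-linear combinations. -/
inductive memP (G : Type) [Group G] [Fintype G] : (G → ℂ) → Prop
  | conj_add (τ : G → ℂ) (hτ : IsGenChar τ) (hdeg : τ 1 = 0) : memP G (τ + conjFun τ)
  | ind (H : Subgroup G) (N : Subgroup ↥H) [hN : N.Normal] (V : FDRep ℂ ↥H)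
      (hdeg : V.character 1 = 2) (htarget : IsTargetGroup (↥H ⧸ N))
      (hfactors : ∀ n : ↥H, n ∈ N → V.ρ n = 1) :
      memP G (indChar H (V.character - 1 - detRep V))
  | zero : memP G 0
  | add (f₁ f₂ : G → ℂ) (h₁ : memP G f₁) (h₂ : memP G f₂) : memP G (f₁ + f₂)
  | neg (f : G → ℂ) (h : memP G f) : memP G (-f)

/-- `𝒫_G` as a set. -/
def PG (G : Type) [Group G] [Fintype G] : Set (G → ℂ) := {f | memP G f}

end

/-! ### Eigenvalues, traces and determinants -/

/-- The eigenvalue multiset of a group element of finite order. -/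
theorem exists_eigenvalues {G : Type} [Group G] [Finite G] (V : FDRep ℂ G) (g : G) :
    ∃ S : Multiset ℂ, (∀ s ∈ S, ‖s‖ = 1) ∧ detRep V g = S.prod ∧
      ∀ k : ℕ, V.character (g ^ k) = (S.map (· ^ k)).sum := by
  set A : Module.End ℂ V := V.ρ g with hA
  obtain ⟨m, hm, hgm⟩ := isOfFinOrder_iff_pow_eq_one.mp (isOfFinOrder_of_finite g)
  have hAm : A ^ m = 1 := by rw [hA, ← map_pow, hgm, map_one]
  have hss : A.IsSemisimple := by
    apply Module.End.isSemisimple_of_squarefree_aeval_eq_zero (p := Polynomial.X ^ m - 1)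
    · have : (Polynomial.X ^ m - Polynomial.C (1 : ℂ)).Separable :=
        Polynomial.separable_X_pow_sub_C 1 (by exact_mod_cast hm.ne') one_ne_zero
      simpa using this.squarefree
    · simp [hAm]
  have hint := DirectSum.isInternal_submodule_of_iSupIndep_of_iSup_eq_top
    A.eigenspaces_iSupIndep hss.iSup_eigenspace_eq_top
  let b := hint.collectedBasis fun μ => Module.finBasis ℂ (A.eigenspace μ)
  have hb : ∀ i, A (b i) = i.1 • b i := fun i =>
    Module.End.mem_eigenspace_iff.mp (hint.collectedBasis_mem _ i)
  have : Fintype (Σ μ, Fin (Module.finrank ℂ (A.eigenspace μ))) :=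
    FiniteDimensional.fintypeBasisIndex b
  have hbk : ∀ k : ℕ, ∀ i, (A ^ k) (b i) = i.1 ^ k • b i := by
    intro k i
    induction k with
    | zero => simp
    | succ k ih => rw [pow_succ', Module.End.mul_apply, ih, map_smul, hb, smul_smul, pow_succ]
  have hmat : ∀ k : ℕ, LinearMap.toMatrix b b (A ^ k) = Matrix.diagonal fun i => i.1 ^ k := by
    intro k
    ext i j
    rw [LinearMap.toMatrix_apply, hbk, map_smul, Module.Basis.repr_self, Matrix.diagonal_apply]
    simp only [Finsupp.smul_apply, Finsupp.single_apply, smul_eq_mul]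
    by_cases h : i = j
    · subst h; simp
    · rw [if_neg h, if_neg (Ne.symm h), mul_zero]
  refine ⟨Finset.univ.val.map
    fun i : Σ μ, Fin (Module.finrank ℂ (A.eigenspace μ)) => i.1, ?_, ?_, ?_⟩
  · intro s hs
    obtain ⟨i, -, rfl⟩ := Multiset.mem_map.mp hs
    have h1 : i.1 ^ m • b i = (1 : ℂ) • b i := by rw [← hbk, hAm]; simp
    have h2 : i.1 ^ m = 1 := smul_left_injective ℂ (b.ne_zero i) h1
    exact Complex.norm_eq_one_of_pow_eq_one h2 hm.ne'
  · have := hmat 1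
    rw [pow_one] at this
    change LinearMap.det A = _
    rw [← LinearMap.det_toMatrix b, this, Matrix.det_diagonal]
    simp only [pow_one]; rfl
  · intro k
    change LinearMap.trace ℂ _ (V.ρ (g ^ k)) = _
    rw [map_pow, LinearMap.trace_eq_matrix_trace ℂ b, ← hA, hmat, Matrix.trace_diagonal]
    rw [Multiset.map_map]; rfl

/-- A multiset of complex numbers is determined by its power sums. -/
theorem multiset_eq_of_powerSums (S T : Multiset ℂ)
    (h : ∀ k : ℕ, (S.map (· ^ k)).sum = (T.map (· ^ k)).sum) : S = T := by
  have hli := linearIndependent_monoidHom (Multiplicative ℕ) ℂ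
  let e : ℂ → (Multiplicative ℕ →* ℂ) := powersHom ℂ
  have he : Function.Injective e := (powersHom ℂ).injective
  have hli' := hli.comp e he
  ext a
  have key : ∀ U : Multiset ℂ, ∀ F : Finset ℂ, U.toFinset ⊆ F → ∀ k : ℕ,
      (U.map (· ^ k)).sum = ∑ s ∈ F, (U.count s : ℂ) * s ^ k := by
    intro U F hF k
    rw [Finset.sum_multiset_map_count, ← Finset.sum_subset hF]
    · simp
    · intro x _ hx
      rw [Multiset.count_eq_zero_of_notMem (by simpa using hx)]
      simp
  have hsum : ∑ s ∈ S.toFinset ∪ T.toFinset,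
      ((S.count s : ℂ) - T.count s) • (fun i : ℂ => (e i : Multiplicative ℕ → ℂ)) s = 0 := by
    ext k
    have := h k.toAdd
    rw [key S _ Finset.subset_union_left, key T _ Finset.subset_union_right] at this
    simp only [Finset.sum_apply, Pi.smul_apply, smul_eq_mul, sub_mul, Finset.sum_sub_distrib,
      Pi.zero_apply]
    rw [sub_eq_zero]
    convert this using 2 <;> rfl
  by_cases ha : a ∈ S.toFinset ∪ T.toFinset
  · have := linearIndependent_iff'.mp hli' _ _ hsum a ha
    exact_mod_cast sub_eq_zero.mp this
  · simp only [Finset.mem_union, Multiset.mem_toFinset, not_or] at ha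
    rw [Multiset.count_eq_zero_of_notMem ha.1, Multiset.count_eq_zero_of_notMem ha.2]

theorem norm_detRep {G : Type} [Group G] [Finite G] (V : FDRep ℂ G) (g : G) :
    ‖detRep V g‖ = 1 := by
  obtain ⟨m, hm, hgm⟩ := isOfFinOrder_iff_pow_eq_one.mp (isOfFinOrder_of_finite g)
  refine Complex.norm_eq_one_of_pow_eq_one (n := m) ?_ hm.ne'
  rw [detRep, ← map_pow, ← map_pow, hgm, map_one, map_one]

theorem detRep_pow {G : Type} [Group G] (V : FDRep ℂ G) (g : G) (k : ℕ) :
    detRep V (g ^ k) = detRep V g ^ k := by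
  simp only [detRep, map_pow]

/-! ### Characters and generalised characters -/

theorem exists_sum_rep {G : Type} [Group G] (V W : FDRep ℂ G) :
    ∃ U : FDRep ℂ G, U.character = V.character + W.character ∧
      detRep U = detRep V * detRep W := by
  refine ⟨FDRep.of (Representation.prod V.ρ W.ρ), ?_, ?_⟩
  · ext g
    exact LinearMap.trace_prodMap' (V.ρ g) (W.ρ g)
  · ext g
    exact LinearMap.det_prodMap (V.ρ g) (W.ρ g)

theorem exists_zero_rep (G : Type) [Group G] :
    ∃ U : FDRep ℂ G, U.character = 0 ∧ detRep U = 1 := by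
  refine ⟨FDRep.of (V := PUnit) 1, ?_, ?_⟩
  · ext g
    change LinearMap.trace ℂ PUnit _ = 0
    rw [Subsingleton.elim ((FDRep.of (V := PUnit) (1 : Representation ℂ G PUnit)).ρ g) 0, map_zero]
  · ext g
    exact LinearMap.det_eq_one_of_subsingleton _

theorem isGenChar_iff {G : Type} [Group G] (f : G → ℂ) :
    IsGenChar f ↔ ∃ V W : FDRep ℂ G, f = V.character - W.character := by
  constructor
  · intro h
    induction h using Submodule.span_induction with
    | mem x hx =>
      obtain ⟨V, rfl⟩ := hx
      obtain ⟨Z, hZ, -⟩ := exists_zero_rep G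
      exact ⟨V, Z, by rw [hZ, sub_zero]⟩
    | zero =>
      obtain ⟨Z, hZ, -⟩ := exists_zero_rep G
      exact ⟨Z, Z, by simp⟩
    | add x y _ _ hx hy =>
      obtain ⟨V, W, rfl⟩ := hx
      obtain ⟨V', W', rfl⟩ := hy
      obtain ⟨A, hA, -⟩ := exists_sum_rep V V'
      obtain ⟨B, hB, -⟩ := exists_sum_rep W W'
      exact ⟨A, B, by rw [hA, hB]; abel⟩
    | smul a x _ hx =>
      have hnat : ∀ (n : ℕ) (V : FDRep ℂ G), ∃ U : FDRep ℂ G,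
          U.character = (n : ℤ) • V.character := by
        intro n V
        induction n with
        | zero =>
          obtain ⟨Z, hZ, -⟩ := exists_zero_rep G
          exact ⟨Z, by simp [hZ]⟩
        | succ n ih =>
          obtain ⟨U, hU⟩ := ih
          obtain ⟨A, hA, -⟩ := exists_sum_rep U V
          exact ⟨A, by rw [hA, hU]; push_cast; rw [add_smul, one_smul]⟩
      obtain ⟨V, W, rfl⟩ := hx
      obtain ⟨n, rfl | rfl⟩ := a.eq_nat_or_neg
      · obtain ⟨A, hA⟩ := hnat n V
        obtain ⟨B, hB⟩ := hnat n W
        exact ⟨A, B, by rw [hA, hB, smul_sub]⟩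
      · obtain ⟨A, hA⟩ := hnat n V
        obtain ⟨B, hB⟩ := hnat n W
        exact ⟨B, A, by rw [hA, hB, neg_smul, smul_sub]; abel⟩
  · rintro ⟨V, W, rfl⟩
    exact Submodule.sub_mem _ (Submodule.subset_span ⟨V, rfl⟩) (Submodule.subset_span ⟨W, rfl⟩)

/-- The pullback of a representation along a group homomorphism. -/
noncomputable def pullRep {G Q : Type} [Group G] [Group Q] (π : G →* Q) (V : FDRep ℂ Q) : FDRep ℂ G :=
  FDRep.of (V.ρ.comp π)

theorem pullRep_character {G Q : Type} [Group G] [Group Q] (π : G →* Q) (V : FDRep ℂ Q) :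
    (pullRep π V).character = V.character ∘ π := rfl

theorem pullRep_det {G Q : Type} [Group G] [Group Q] (π : G →* Q) (V : FDRep ℂ Q) :
    detRep (pullRep π V) = detRep V ∘ π := rfl

theorem IsGenChar.comp {G Q : Type} [Group G] [Group Q] {f : Q → ℂ} (hf : IsGenChar f)
    (π : G →* Q) : IsGenChar (f ∘ π) := by
  obtain ⟨V, W, rfl⟩ := (isGenChar_iff f).mp hf
  exact (isGenChar_iff _).mpr ⟨pullRep π V, pullRep π W, rfl⟩

theorem HasTrivialDet.comp {G Q : Type} [Group G] [Group Q] {f : Q → ℂ} (hf : HasTrivialDet f)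
    (π : G →* Q) : HasTrivialDet (f ∘ π) := by
  obtain ⟨V, W, rfl, h⟩ := hf
  exact ⟨pullRep π V, pullRep π W, rfl, fun g => h (π g)⟩

theorem IsGenChar.linear_mul {G : Type} [Group G] {f : G → ℂ} (hf : IsGenChar f) (ε : G →* ℂ) :
    IsGenChar (fun g => ε g * f g) := by
  have key : ∀ V : FDRep ℂ G, ∃ U : FDRep ℂ G, U.character = fun g => ε g * V.character g := by
    intro V
    let ρ : Representation ℂ G V :=
      { toFun := fun g => ε g • V.ρ g
        map_one' := by simp
        map_mul' := fun x y => by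
          rw [map_mul, map_mul, smul_mul_smul_comm] }
    refine ⟨FDRep.of ρ, ?_⟩
    ext g
    change LinearMap.trace ℂ V (ε g • V.ρ g) = _
    rw [map_smul]; rfl
  obtain ⟨V, W, rfl⟩ := (isGenChar_iff f).mp hf
  obtain ⟨A, hA⟩ := key V
  obtain ⟨B, hB⟩ := key W
  refine (isGenChar_iff _).mpr ⟨A, B, ?_⟩
  ext g
  simp [hA, hB, mul_sub]

theorem isGenChar_linear {G : Type} [Group G] (ε : G →* ℂ) : IsGenChar (fun g => ε g) := by
  refine Submodule.subset_span
    ⟨FDRep.of (V := ℂ) ((algebraMap ℂ (Module.End ℂ ℂ)).toMonoidHom.comp ε), ?_⟩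
  ext g
  change LinearMap.trace ℂ ℂ (algebraMap ℂ (Module.End ℂ ℂ) (ε g)) = _
  rw [Algebra.algebraMap_eq_smul_one, map_smul, LinearMap.trace_one]
  simp

theorem isGenChar_one (G : Type) [Group G] : IsGenChar (1 : G → ℂ) :=
  isGenChar_linear (1 : G →* ℂ)

theorem IsGenChar.add {G : Type} [Group G] {f₁ f₂ : G → ℂ} (h₁ : IsGenChar f₁)
    (h₂ : IsGenChar f₂) : IsGenChar (f₁ + f₂) := Submodule.add_mem _ h₁ h₂

theorem IsGenChar.sub {G : Type} [Group G] {f₁ f₂ : G → ℂ} (h₁ : IsGenChar f₁)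
    (h₂ : IsGenChar f₂) : IsGenChar (f₁ - f₂) := Submodule.sub_mem _ h₁ h₂

theorem IsGenChar.neg {G : Type} [Group G] {f : G → ℂ} (h : IsGenChar f) : IsGenChar (-f) :=
  Submodule.neg_mem _ h

/-! ### Induction of class functions -/

/-- The sum of all conjugates of a function on a finite group. -/
noncomputable def conjSum {G : Type} [Group G] [Fintype G] (F : G → ℂ) : G → ℂ :=
  fun g => ∑ x : G, F (x⁻¹ * g * x)

theorem conjSum_conj {G : Type} [Group G] [Fintype G] (F : G → ℂ) (t : G) :
    conjSum (fun g => F (t⁻¹ * g * t)) = conjSum F := by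
  ext g
  refine Fintype.sum_equiv (Equiv.mulRight t) _ _ fun x => ?_
  simp [mul_assoc]

theorem conjSum_sub {G : Type} [Group G] [Fintype G] (F₁ F₂ : G → ℂ) :
    conjSum (F₁ - F₂) = conjSum F₁ - conjSum F₂ := by
  ext g; simp [conjSum]

theorem conjSum_add {G : Type} [Group G] [Fintype G] (F₁ F₂ : G → ℂ) :
    conjSum (F₁ + F₂) = conjSum F₁ + conjSum F₂ := by
  ext g; simp [conjSum, Finset.sum_add_distrib]

theorem conjSum_smul {G : Type} [Group G] [Fintype G] (c : ℂ) (F : G → ℂ) :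
    conjSum (c • F) = c • conjSum F := by
  ext g; simp [conjSum, Finset.mul_sum]

theorem conjSum_sum {G ι : Type} [Group G] [Fintype G] (s : Finset ι) (F : ι → G → ℂ) :
    conjSum (∑ i ∈ s, F i) = ∑ i ∈ s, conjSum (F i) := by
  ext g; simp only [conjSum, Finset.sum_apply]; exact Finset.sum_comm

/-- Induction to `G` of the restriction to `H` of a function on `G`. -/
theorem indChar_eq_conjSum {G : Type} [Group G] [Fintype G] (H : Subgroup G) (f : H → ℂ)
    (F : G → ℂ) (hF : ∀ x : H, f x = F x) :
    indChar H f = (Nat.card H : ℂ)⁻¹ • conjSum (fun g => if g ∈ H then F g else 0) := by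
  ext g
  simp only [indChar, conjSum, Pi.smul_apply, smul_eq_mul]
  congr 1
  refine Finset.sum_congr rfl fun x _ => ?_
  by_cases h : x⁻¹ * g * x ∈ H
  · rw [dif_pos h, if_pos h, hF]
  · rw [dif_neg h, if_neg h]

theorem natCard_eq_sum {G : Type} [Group G] [Fintype G] (H : Subgroup G) :
    (Nat.card H : ℂ) = ∑ x : G, if x ∈ H then 1 else 0 := by
  rw [Finset.sum_boole, Nat.card_eq_fintype_card, Fintype.card_subtype]

theorem isGenChar_indChar_linear {G : Type} [Group G] [Fintype G] (H : Subgroup G)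
    (χ : H →* ℂ) : IsGenChar (indChar H χ) := by
  let W : Submodule ℂ (G → ℂ) :=
    { carrier := {F | ∀ (h : H) (x : G), F (h * x) = χ h * F x}
      add_mem' := fun {a b} ha hb h x => by simp [ha h x, hb h x, mul_add]
      zero_mem' := fun h x => by simp
      smul_mem' := fun c a ha h x => by simp [ha h x]; ring }
  let R : Representation ℂ G (G → ℂ) :=
    { toFun := fun g => LinearMap.funLeft ℂ ℂ (fun x => x * g)
      map_one' := by ext; simp [LinearMap.funLeft]
      map_mul' := fun a b => by ext; simp [LinearMap.funLeft, mul_assoc] }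
  have hR : ∀ g F x, R g F x = F (x * g) := fun _ _ _ => rfl
  have hRW : ∀ g, ∀ F ∈ W, R g F ∈ W := fun g F hF h x => by
    rw [hR, hR, mul_assoc]; exact hF h _
  let RW : Representation ℂ G W :=
    { toFun := fun g => (R g).restrict (hRW g)
      map_one' := by ext F x; simp
      map_mul' := fun a b => by ext F x; simp [hR] }
  have hχ : ∀ h : H, χ h * χ h⁻¹ = 1 := fun h => by rw [← map_mul, mul_inv_cancel, map_one]
  let pr : (G → ℂ) →ₗ[ℂ] (G → ℂ) :=
    (Nat.card H : ℂ)⁻¹ • ∑ h : H, χ h⁻¹ • LinearMap.funLeft ℂ ℂ (fun x => (h : G) * x)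
  have hpr : ∀ F x, pr F x = (Nat.card H : ℂ)⁻¹ * ∑ h : H, χ h⁻¹ * F (h * x) := by
    intro F x
    simp [pr, LinearMap.sum_apply, LinearMap.funLeft]
  have hprW : ∀ F, pr F ∈ W := by
    intro F h x
    rw [hpr, hpr, mul_left_comm]
    congr 1
    rw [Finset.mul_sum]
    refine Fintype.sum_equiv (Equiv.mulRight h) _ _ fun k => ?_
    simp only [Equiv.coe_mulRight, mul_inv_rev, map_mul, Subgroup.coe_mul, mul_assoc]
    rw [← mul_assoc (χ h), hχ, one_mul]
  let π : (G → ℂ) →ₗ[ℂ] W := pr.codRestrict W hprW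
  have hcard : (Nat.card H : ℂ) ≠ 0 := by exact_mod_cast Nat.card_pos.ne'
  have hπ : ∀ F : W, π F = F := by
    intro F
    ext x
    change pr F x = _
    rw [hpr]
    have : ∀ h : H, χ h⁻¹ * (F : G → ℂ) (h * x) = (F : G → ℂ) x := fun h => by
      rw [F.2 h x, ← mul_assoc, mul_comm (χ _), hχ, one_mul]
    rw [Finset.sum_congr rfl fun h _ => this h]
    rw [Finset.sum_const, Finset.card_univ, ← Nat.card_eq_fintype_card, nsmul_eq_mul,
      inv_mul_cancel_left₀ hcard]
  refine Submodule.subset_span ⟨FDRep.of RW, ?_⟩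
  ext g
  change LinearMap.trace ℂ W (RW g) = _
  have h1 : RW g = π ∘ₗ (R g ∘ₗ W.subtype) := by
    ext F x
    have : π (R g F) = ⟨R g F, hRW g F F.2⟩ := hπ ⟨R g F, hRW g F F.2⟩
    simp only [LinearMap.comp_apply, Submodule.subtype_apply, this]
    rfl
  rw [h1, LinearMap.trace_comp_comm', LinearMap.trace_eq_matrix_trace ℂ (Pi.basisFun ℂ G),
    Matrix.trace, indChar, Finset.mul_sum]
  refine Fintype.sum_equiv (Equiv.inv G) _ _ fun x => ?_
  rw [Matrix.diag_apply, LinearMap.toMatrix_apply]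
  simp only [Pi.basisFun_apply, Pi.basisFun_repr, LinearMap.comp_apply, Submodule.subtype_apply,
    Equiv.inv_apply, inv_inv]
  change pr _ (x * g) = _
  rw [hpr]
  congr 1
  split_ifs with h
  · rw [Finset.sum_eq_single (⟨x * g * x⁻¹, h⟩⁻¹ : H)]
    · simp [mul_assoc]
    · intro k _ hk
      rw [Pi.single_eq_of_ne, mul_zero]
      intro h'
      apply hk
      ext
      simp only [Subgroup.coe_inv]
      rw [eq_inv_iff_mul_eq_one, ← mul_assoc, h', mul_inv_cancel]
    · simp
  · refine Finset.sum_eq_zero fun k _ => ?_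
    rw [Pi.single_eq_of_ne, mul_zero]
    intro h'
    apply h
    have : x * g * x⁻¹ = (k : G)⁻¹ :=
      eq_inv_of_mul_eq_one_right (by rw [← mul_assoc, h', mul_inv_cancel])
    rw [this]
    exact inv_mem k.2

theorem isGenChar_indChar_one {G : Type} [Group G] [Fintype G] (H : Subgroup G) :
    IsGenChar (indChar H 1) :=
  isGenChar_indChar_linear H (1 : H →* ℂ)

theorem IsPermChar.isGenChar {G : Type} [Group G] [Fintype G] {f : G → ℂ} (hf : IsPermChar f) :
    IsGenChar f := by
  have : {f : G → ℂ | ∃ H : Subgroup G, f = indChar H 1} ⊆ {f : G → ℂ | IsGenChar f} := by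
    rintro _ ⟨H, rfl⟩; exact isGenChar_indChar_one H
  exact (Submodule.span_le.mpr this : _ ≤ Submodule.span ℤ {f : G → ℂ | IsChar f}) hf

theorem IsPermChar.conjFun_eq {G : Type} [Group G] [Fintype G] {f : G → ℂ} (hf : IsPermChar f) :
    conjFun f = f := by
  induction hf using Submodule.span_induction with
  | mem x hx =>
    obtain ⟨H, rfl⟩ := hx
    ext g
    simp only [conjFun, indChar, map_mul, map_inv₀, map_natCast, map_sum]
    congr 1
    refine Finset.sum_congr rfl fun x _ => ?_
    split_ifs <;> simp
  | zero => ext; simp [conjFun]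
  | add x y _ _ hx hy =>
    ext g
    have h1 := congrFun hx g
    have h2 := congrFun hy g
    simp only [conjFun] at h1 h2
    simp [conjFun, h1, h2]
  | smul a x _ hx =>
    ext g
    have h1 := congrFun hx g
    simp only [conjFun] at h1
    simp [conjFun, h1]

theorem indChar_one_top (G : Type) [Group G] [Fintype G] : indChar (⊤ : Subgroup G) 1 = 1 := by
  ext g
  simp [indChar]

theorem isPermChar_one (G : Type) [Group G] [Fintype G] : IsPermChar (1 : G → ℂ) :=
  Submodule.subset_span ⟨⊤, (indChar_one_top G).symm⟩

theorem indChar_apply_one {G : Type} [Group G] [Fintype G] (H : Subgroup G) :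
    indChar H 1 1 = H.index := by
  simp only [indChar, mul_one, inv_mul_cancel, one_mem, dite_true, Pi.one_apply, Finset.sum_const,
    Finset.card_univ, nsmul_eq_mul]
  rw [← Nat.card_eq_fintype_card, ← H.index_mul_card]
  have hcard : (Nat.card H : ℂ) ≠ 0 := by exact_mod_cast Nat.card_pos.ne'
  push_cast
  field_simp

theorem IsPermChar.exists_degree {G : Type} [Group G] [Fintype G] {f : G → ℂ}
    (hf : IsPermChar f) : ∃ n : ℤ, f 1 = n := by
  induction hf using Submodule.span_induction with
  | mem x hx =>
    obtain ⟨H, rfl⟩ := hx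
    exact ⟨H.index, by rw [indChar_apply_one]; simp⟩
  | zero => exact ⟨0, by simp⟩
  | add x y _ _ hx hy =>
    obtain ⟨m, hm⟩ := hx
    obtain ⟨n, hn⟩ := hy
    exact ⟨m + n, by simp [hm, hn]⟩
  | smul a x _ hx =>
    obtain ⟨m, hm⟩ := hx
    exact ⟨a * m, by simp [hm]⟩

/-! ### Inflation -/

theorem sum_comp_surjective {G Q : Type} [Group G] [Fintype G] [Group Q] [Fintype Q]
    (π : G →* Q) (hπ : Function.Surjective π) (Φ : Q → ℂ) :
    ∑ x : G, Φ (π x) = Nat.card π.ker * ∑ y : Q, Φ y := by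
  rw [← Finset.sum_fiberwise_of_maps_to (s := Finset.univ) (t := Finset.univ) (g := π)
    (fun _ _ => Finset.mem_univ _), Finset.mul_sum]
  refine Finset.sum_congr rfl fun y _ => ?_
  rw [Finset.sum_congr rfl (g := fun _ => Φ y) (fun x hx => by rw [(Finset.mem_filter.mp hx).2]),
    Finset.sum_const, nsmul_eq_mul]
  congr 2
  rw [MonoidHom.card_fiber_eq_of_mem_range π (hπ y) ⟨1, map_one π⟩, Nat.card_eq_fintype_card,
    Fintype.card_subtype]
  congr 1
  ext x
  simp [MonoidHom.mem_ker]

theorem indChar_comap {G Q : Type} [Group G] [Fintype G] [Group Q] [Fintype Q]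
    (π : G →* Q) (hπ : Function.Surjective π) (H : Subgroup Q) (f : H → ℂ) :
    indChar (H.comap π) (fun x => f ⟨π x, x.2⟩) = indChar H f ∘ π := by
  have hker : (Nat.card π.ker : ℂ) ≠ 0 := by exact_mod_cast Nat.card_pos.ne'
  have hcard : (Nat.card (H.comap π) : ℂ) = Nat.card π.ker * Nat.card H := by
    rw [natCard_eq_sum, natCard_eq_sum H, ← sum_comp_surjective π hπ]
    rfl
  ext g
  simp only [indChar, Function.comp_apply]
  rw [hcard, mul_inv, mul_comm (_⁻¹) (_⁻¹), mul_assoc]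
  congr 1
  rw [inv_mul_eq_iff_eq_mul₀ hker, ← sum_comp_surjective π hπ]
  refine Finset.sum_congr rfl fun x _ => ?_
  simp only [Subgroup.mem_comap, map_mul, map_inv]

theorem IsTargetGroup.of_mulEquiv {Q R : Type} [Group Q] [Group R] (h : IsTargetGroup Q)
    (e : R ≃* Q) : IsTargetGroup R := by
  rcases h with ⟨⟨i⟩⟩ | ⟨⟨i⟩⟩ | ⟨p, h1, h2, ⟨i⟩⟩
  · exact Or.inl ⟨e.trans i⟩
  · exact Or.inr (Or.inl ⟨e.trans i⟩)
  · exact Or.inr (Or.inr ⟨p, h1, h2, ⟨e.trans i⟩⟩)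

/-- Inflation along a surjection maps `𝒫` into `𝒫`. -/
theorem memP.comp {G Q : Type} [Group G] [Fintype G] [Group Q] [Fintype Q]
    (π : G →* Q) (hπ : Function.Surjective π) {f : Q → ℂ} (hf : memP Q f) : memP G (f ∘ π) := by
  induction hf with
  | conj_add τ hτ hdeg =>
    exact memP.conj_add (τ ∘ π) (hτ.comp π) (by simp [hdeg])
  | ind H N V hdeg htarget hfactors =>
    let q : H.comap π →* H := π.subgroupComap H
    have hq : Function.Surjective q := π.subgroupComap_surjective_of_surjective H hπ
    let q' : H.comap π →* H ⧸ N := (QuotientGroup.mk' N).comp q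
    have hq' : Function.Surjective q' := (QuotientGroup.mk'_surjective N).comp hq
    have hmem : ∀ x, x ∈ q'.ker ↔ q x ∈ N := fun x => by
      rw [MonoidHom.mem_ker]; exact QuotientGroup.eq_one_iff _
    have := memP.ind (H.comap π) q'.ker (pullRep q V) (by rw [pullRep_character]; simpa using hdeg)
      (htarget.of_mulEquiv (QuotientGroup.quotientKerEquivOfSurjective q' hq'))
      (fun n hn => hfactors (q n) ((hmem n).mp hn))
    rw [← indChar_comap π hπ]
    exact this
  | zero => exact memP.zero
  | add f₁ f₂ _ _ h₁ h₂ => exact memP.add _ _ h₁ h₂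
  | neg f _ h => exact memP.neg _ h

/-! ### Affine actions -/

theorem sum_mulShift_stdAddChar {m : ℕ} [NeZero m] (v : ZMod m) :
    ∑ a : ZMod m, (ZMod.stdAddChar (N := m)).mulShift a v = if v = 0 then (m : ℂ) else 0 := by
  simp only [AddChar.mulShift_apply]
  rw [AddChar.sum_mulShift v (ZMod.isPrimitive_stdAddChar m), ZMod.card]
  simp

/-- A subgroup `X` acting on `ℤ/m` by affine maps `v ↦ φ x * v + b x`, with the translation
`v ↦ v + 1` realised by `w`, and such that `H` is the stabiliser of `0`. -/
structure AffineAction {G : Type} [Group G] (m : ℕ) (X H : Subgroup G) where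
  φ : G →* (ZMod m)ˣ
  b : G → ZMod m
  b_mul : ∀ x ∈ X, ∀ y ∈ X, b (x * y) = b x + φ x * b y
  w : G
  w_mem : w ∈ X
  b_w : b w = 1
  φ_w : φ w = 1
  mem_iff : ∀ x, x ∈ H ↔ x ∈ X ∧ b x = 0

namespace AffineAction

variable {G : Type} [Group G] {m : ℕ} {X H : Subgroup G} (D : AffineAction m X H)

/-- The subgroup of `X` acting by translations. -/
def C : Subgroup G := X ⊓ D.φ.ker

theorem mem_C {x : G} : x ∈ D.C ↔ x ∈ X ∧ D.φ x = 1 := Iff.rfl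

theorem C_le : D.C ≤ X := inf_le_left

theorem b_one : D.b 1 = 0 := by
  have := D.b_mul 1 X.one_mem 1 X.one_mem
  simpa using this

theorem b_inv {x : G} (hx : x ∈ X) : D.b x⁻¹ = -(((D.φ x)⁻¹ : (ZMod m)ˣ) * D.b x) := by
  have := D.b_mul x⁻¹ (X.inv_mem hx) x hx
  rw [inv_mul_cancel, D.b_one, map_inv] at this
  exact eq_neg_of_add_eq_zero_left this.symm

theorem b_mul_of_mem_C {x y : G} (hx : x ∈ D.C) (hy : y ∈ X) : D.b (x * y) = D.b x + D.b y := by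
  rw [D.b_mul x hx.1 y hy, D.mem_C.mp hx |>.2, Units.val_one, one_mul]

theorem b_conj {x g : G} (hx : x ∈ X) (hg : g ∈ D.C) :
    D.b (x * g * x⁻¹) = D.φ x * D.b g := by
  rw [D.b_mul _ (X.mul_mem hx hg.1) _ (X.inv_mem hx), D.b_mul x hx g hg.1, D.b_inv hx, map_mul,
    (D.mem_C.mp hg).2]
  simp

theorem conj_mem_C {x g : G} (hx : x ∈ X) : x * g * x⁻¹ ∈ D.C ↔ g ∈ D.C := by
  rw [mem_C, mem_C]
  have h1 : x * g * x⁻¹ ∈ X ↔ g ∈ X := by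
    rw [X.mul_mem_cancel_right (X.inv_mem hx), X.mul_mem_cancel_left hx]
  have h2 : D.φ (x * g * x⁻¹) = D.φ g := by
    rw [map_mul, map_mul, map_inv, mul_comm (D.φ x), mul_inv_cancel_right]
  rw [h1, h2]

theorem w_mem_C : D.w ∈ D.C := D.mem_C.mpr ⟨D.w_mem, D.φ_w⟩

theorem b_w_pow (k : ℕ) : D.b (D.w ^ k) = k := by
  induction k with
  | zero => simpa using D.b_one
  | succ k ih =>
    rw [pow_succ, D.b_mul_of_mem_C (D.C.pow_mem D.w_mem_C k) D.w_mem, ih, D.b_w]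
    simp

theorem b_pow_of_mem_C {x : G} (hx : x ∈ D.C) (k : ℕ) : D.b (x ^ k) = k * D.b x := by
  induction k with
  | zero => simpa using D.b_one
  | succ k ih =>
    rw [pow_succ, D.b_mul_of_mem_C (D.C.pow_mem hx k) hx.1, ih]
    push_cast; ring

/-- Translation by `i` inside `X`. -/
def wpow (i : ZMod m) : G := D.w ^ i.val

theorem wpow_mem_C (i : ZMod m) : D.wpow i ∈ D.C := D.C.pow_mem D.w_mem_C _

theorem b_wpow [NeZero m] (i : ZMod m) : D.b (D.wpow i) = i := by
  rw [wpow, b_w_pow, ZMod.natCast_zmod_val]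

variable [Fintype G]

theorem card_eq [NeZero m] (D : AffineAction m X H) : (Nat.card X : ℂ) = m * Nat.card H := by
  have h1 : ∀ i : ZMod m, (∑ x : G, if x ∈ X ∧ D.b x = i then (1 : ℂ) else 0) = Nat.card H := by
    intro i
    rw [natCard_eq_sum]
    symm
    refine Fintype.sum_equiv (Equiv.mulLeft (D.wpow i)) _ _ fun x => ?_
    have hw := D.wpow_mem_C i
    simp only [Equiv.coe_mulLeft, D.mem_iff, X.mul_mem_cancel_left hw.1]
    refine if_congr (and_congr_right fun hx => ?_) rfl rfl
    rw [D.b_mul_of_mem_C hw hx, D.b_wpow]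
    simp
  calc (Nat.card X : ℂ) = ∑ x : G, ∑ i : ZMod m, if x ∈ X ∧ D.b x = i then (1 : ℂ) else 0 := by
        rw [natCard_eq_sum]
        refine Finset.sum_congr rfl fun x _ => ?_
        by_cases hx : x ∈ X <;> simp [hx]
    _ = ∑ i : ZMod m, (Nat.card H : ℂ) := by
        rw [Finset.sum_comm]
        exact Finset.sum_congr rfl fun i _ => h1 i
    _ = _ := by simp [ZMod.card]

/-- The character of `C` attached to an additive character of `ℤ/m`, extended by zero to `G`. -/
noncomputable def extC (χ : AddChar (ZMod m) ℂ) : G → ℂ := fun g => if g ∈ D.C then χ (D.b g) else 0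

/-- The character of `G` induced from the character of `C` attached to an additive character
of `ℤ/m`. -/
noncomputable def T (χ : AddChar (ZMod m) ℂ) : G → ℂ := indChar D.C fun x => χ (D.b x)

theorem T_eq (χ : AddChar (ZMod m) ℂ) : D.T χ = (Nat.card D.C : ℂ)⁻¹ • conjSum (D.extC χ) :=
  indChar_eq_conjSum D.C _ (fun g => χ (D.b g)) fun _ => rfl

theorem conjSum_extC (χ : AddChar (ZMod m) ℂ) : conjSum (D.extC χ) = (Nat.card D.C : ℂ) • D.T χ := by
  have hcard : (Nat.card D.C : ℂ) ≠ 0 := by exact_mod_cast Nat.card_pos.ne'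
  rw [T_eq, smul_inv_smul₀ hcard]

theorem isGenChar_T (χ : AddChar (ZMod m) ℂ) : IsGenChar (D.T χ) :=
  isGenChar_indChar_linear D.C
    { toFun := fun x => χ (D.b x)
      map_one' := by simp [D.b_one]
      map_mul' := fun x y => by
        rw [Subgroup.coe_mul, D.b_mul_of_mem_C x.2 y.2.1, AddChar.map_add_eq_mul] }

theorem T_apply_one (χ : AddChar (ZMod m) ℂ) : D.T χ 1 = indChar D.C 1 1 := by
  simp only [T, indChar]
  congr 1
  refine Finset.sum_congr rfl fun x _ => ?_
  simp [D.C.one_mem, D.b_one]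

theorem T_mulShift (χ : AddChar (ZMod m) ℂ) {x : G} (hx : x ∈ X) :
    D.T (χ.mulShift (D.φ x)) = D.T χ := by
  rw [T_eq, T_eq, ← conjSum_conj (D.extC χ) x⁻¹]
  congr 2
  ext g
  simp only [extC, inv_inv, D.conj_mem_C hx]
  split_ifs with hg
  · rw [D.b_conj hx hg, AddChar.mulShift_apply]
  · rfl

theorem conjFun_T [NeZero m] (χ : AddChar (ZMod m) ℂ) : conjFun (D.T χ) = D.T χ⁻¹ := by
  ext g
  simp only [conjFun, T, indChar, map_mul, map_inv₀, map_natCast, map_sum]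
  congr 1
  refine Finset.sum_congr rfl fun x _ => ?_
  split_ifs
  · rw [AddChar.inv_apply, AddChar.map_neg_eq_conj]
  · simp

theorem indChar_eq_sum_of_le_ker [NeZero m] (hX : X ≤ D.φ.ker) :
    indChar H 1 = ∑ a : ZMod m, D.T (ZMod.stdAddChar.mulShift a) := by
  have hC : D.C = X := inf_eq_left.mpr hX
  have hm : (m : ℂ) ≠ 0 := by exact_mod_cast NeZero.ne m
  rw [indChar_eq_conjSum H 1 1 fun _ => rfl]
  simp only [T_eq]
  rw [← Finset.smul_sum, ← conjSum_sum, hC, D.card_eq, mul_inv, mul_comm (m : ℂ)⁻¹, mul_smul,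
    ← conjSum_smul (m : ℂ)⁻¹]
  congr 2
  ext g
  simp only [Pi.smul_apply, Finset.sum_apply, extC, hC, D.mem_iff, smul_eq_mul, Pi.one_apply]
  by_cases hg : g ∈ X
  · simp only [hg, if_true, true_and]
    rw [sum_mulShift_stdAddChar]
    split_ifs <;> simp [hm]
  · simp [hg]

end AffineAction

theorem sum_zmod_eq_add_sum_units {p : ℕ} [Fact p.Prime] (f : ZMod p → ℂ) :
    ∑ a, f a = f 0 + ∑ u : (ZMod p)ˣ, f u := by
  rw [← Fintype.sum_subtype_add_sum_subtype (fun a : ZMod p => a = 0)]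
  congr 1
  · simp only [Finset.univ_unique, Finset.sum_singleton]
    exact congrArg f (default : {a : ZMod p // a = 0}).2
  · exact (Fintype.sum_equiv unitsEquivNeZero _ _ fun u => rfl).symm

namespace AffineAction

variable {G : Type} [Group G] {p : ℕ} {X H : Subgroup G} (D : AffineAction p X H)

theorem card_C : (Nat.card X : ℂ) = Nat.card (X.map D.φ) * Nat.card D.C := by
  rw [← Subgroup.relIndex_ker, ← Subgroup.inf_relIndex_left]
  have := Subgroup.relIndex_mul_relIndex (⊥ : Subgroup G) D.C X bot_le D.C_le
  rw [Subgroup.relIndex_bot_left, Subgroup.relIndex_bot_left] at this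
  rw [← this, mul_comm]
  push_cast
  rfl

variable [Fact p.Prime]

theorem sum_wpow_conj_mem (g : G) :
    (∑ i : ZMod p, if (D.wpow i)⁻¹ * g * D.wpow i ∈ H then (1 : ℂ) else 0) =
      (if g ∈ X then 1 else 0) +
        ∑ u : (ZMod p)ˣ, D.extC (ZMod.stdAddChar.mulShift (u : ZMod p)) g := by
  by_cases hg : g ∈ X
  swap
  · have h1 : g ∉ D.C := fun h => hg h.1
    have h2 : ∀ i, (D.wpow i)⁻¹ * g * D.wpow i ∉ H := fun i hi => by
      have h3 := ((D.mem_iff _).mp hi).1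
      have hw := (D.wpow_mem_C i).1
      rw [X.mul_mem_cancel_right hw, X.mul_mem_cancel_left (X.inv_mem hw)] at h3
      exact hg h3
    simp [h1, h2, hg, extC]
  have key : ∀ i, (D.wpow i)⁻¹ * g * D.wpow i ∈ H ↔ D.b g + (D.φ g - 1) * i = 0 := by
    intro i
    have hw := D.wpow_mem_C i
    have hwX := hw.1
    have hwi : (D.wpow i)⁻¹ ∈ D.C := D.C.inv_mem hw
    have hbi : D.b (D.wpow i)⁻¹ = -i := by
      rw [D.b_inv hwX, (D.mem_C.mp hw).2, D.b_wpow]; simp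
    rw [D.mem_iff, mul_assoc, D.b_mul_of_mem_C hwi (X.mul_mem hg hwX), D.b_mul g hg _ hwX, hbi,
      D.b_wpow, and_iff_right (X.mul_mem hwi.1 (X.mul_mem hg hwX))]
    ring_nf
  simp only [key, hg, if_true]
  by_cases hφ : D.φ g = 1
  · have hC : g ∈ D.C := D.mem_C.mpr ⟨hg, hφ⟩
    have := sum_zmod_eq_add_sum_units
      fun a : ZMod p => (ZMod.stdAddChar.mulShift a) (D.b g)
    rw [sum_mulShift_stdAddChar] at this
    simp only [extC, hC, if_true, hφ]
    simp only [AddChar.mulShift_apply, zero_mul, AddChar.map_zero_eq_one] at this ⊢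
    rw [← this]
    simp [ZMod.card]
  · have hC : g ∉ D.C := fun h => hφ (D.mem_C.mp h).2
    have h1 : (D.φ g : ZMod p) - 1 ≠ 0 := fun h => hφ (Units.ext (sub_eq_zero.mp h))
    have h2 : ∀ i : ZMod p, D.b g + (D.φ g - 1) * i = 0 ↔ i = -(D.b g) / (D.φ g - 1) := by
      intro i
      rw [eq_div_iff h1, eq_neg_iff_add_eq_zero, add_comm, mul_comm]
    simp only [h2, extC, hC, if_false]
    simp

variable [Fintype G]

theorem indChar_eq_add_sum_units :
    indChar H 1 = indChar X 1 + (Nat.card (X.map D.φ) : ℂ)⁻¹ •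
      ∑ u : (ZMod p)ˣ, D.T (ZMod.stdAddChar.mulShift (u : ZMod p)) := by
  have hp : (p : ℂ) ≠ 0 := by exact_mod_cast (Fact.out : p.Prime).ne_zero
  have hC : (Nat.card D.C : ℂ) ≠ 0 := by exact_mod_cast Nat.card_pos.ne'
  have hI : (Nat.card (X.map D.φ) : ℂ) ≠ 0 := by exact_mod_cast Nat.card_pos.ne'
  have hX : (Nat.card X : ℂ) ≠ 0 := by exact_mod_cast Nat.card_pos.ne'
  have hH : (Nat.card H : ℂ) ≠ 0 := by exact_mod_cast Nat.card_pos.ne'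
  have key : (p : ℂ) • conjSum (fun g => if g ∈ H then (1 : ℂ) else 0) =
      conjSum (fun g => if g ∈ X then (1 : ℂ) else 0) +
        ∑ u : (ZMod p)ˣ, conjSum (D.extC (ZMod.stdAddChar.mulShift (u : ZMod p))) := by
    rw [← conjSum_sum, ← conjSum_add]
    have h1 : (p : ℂ) • conjSum (fun g => if g ∈ H then (1 : ℂ) else 0) =
        ∑ i : ZMod p, conjSum (fun g => if (D.wpow i)⁻¹ * g * D.wpow i ∈ H then (1 : ℂ) else 0) := by
      rw [Finset.sum_congr rfl fun i _ =>
        conjSum_conj (fun g => if g ∈ H then (1 : ℂ) else 0) (D.wpow i)]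
      rw [Finset.sum_const, Finset.card_univ, ZMod.card, Nat.cast_smul_eq_nsmul]
    rw [h1, ← conjSum_sum]
    congr 1
    ext g
    simpa using D.sum_wpow_conj_mem g
  rw [indChar_eq_conjSum H 1 1 fun _ => rfl, indChar_eq_conjSum X 1 1 fun _ => rfl]
  simp only [Pi.one_apply]
  simp only [D.conjSum_extC] at key
  rw [← Finset.smul_sum] at key
  have h2 : (Nat.card (X.map D.φ) : ℂ)⁻¹ = (Nat.card X : ℂ)⁻¹ * Nat.card D.C := by
    rw [D.card_C]; field_simp
  rw [h2, mul_smul, ← smul_add, ← key, smul_smul, D.card_eq]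
  congr 1
  field_simp

theorem T_eq_of_mk_eq (χ : AddChar (ZMod p) ℂ) {u v : (ZMod p)ˣ}
    (h : (QuotientGroup.mk u : (ZMod p)ˣ ⧸ X.map D.φ) = QuotientGroup.mk v) :
    D.T (χ.mulShift (u : ZMod p)) = D.T (χ.mulShift (v : ZMod p)) := by
  obtain ⟨x, hx, hxu⟩ := QuotientGroup.eq.mp h
  have hv : v = u * D.φ x := by rw [hxu, mul_inv_cancel_left]
  rw [hv, ← D.T_mulShift (χ.mulShift (u : ZMod p)) hx]
  congr 1
  ext a
  simp [AddChar.mulShift_apply, mul_assoc]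

theorem indChar_sub_eq_sum_quotient :
    indChar H 1 - indChar X 1 =
      ∑ q : (ZMod p)ˣ ⧸ X.map D.φ, D.T (ZMod.stdAddChar.mulShift (q.out : ZMod p)) := by
  have hI : (Nat.card (X.map D.φ) : ℂ) ≠ 0 := by exact_mod_cast Nat.card_pos.ne'
  rw [D.indChar_eq_add_sum_units, add_sub_cancel_left, inv_smul_eq_iff₀ hI]
  ext g
  have := sum_comp_surjective (QuotientGroup.mk' (X.map D.φ)) (QuotientGroup.mk'_surjective _)
    fun q => D.T (ZMod.stdAddChar.mulShift (q.out : ZMod p)) g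
  rw [QuotientGroup.ker_mk'] at this
  simp only [Pi.smul_apply, Finset.sum_apply, smul_eq_mul]
  rw [← this]
  refine Finset.sum_congr rfl fun u _ => ?_
  rw [D.T_eq_of_mk_eq ZMod.stdAddChar (u := u)]
  exact (QuotientGroup.out_eq' _).symm

end AffineAction

/-! ### Dihedral groups -/

/-- The two-dimensional representation of a dihedral group induced from a character of the
rotation subgroup, in matrix form. -/
noncomputable def dihedralMatrix {m : ℕ} (χ : AddChar (ZMod m) ℂ) :
    DihedralGroup m →* Matrix (Fin 2) (Fin 2) ℂ where
  toFun
    | .r i => !![χ i, 0; 0, χ (-i)]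
    | .sr i => !![0, χ (-i); χ i, 0]
  map_one' := by
    rw [DihedralGroup.one_def]
    simp [Matrix.one_fin_two]
  map_mul' := by
    rintro (i | i) (j | j) <;>
      simp [← AddChar.map_add_eq_mul, sub_eq_add_neg, add_comm]

/-- The two-dimensional representation of a dihedral group induced from a character of the
rotation subgroup. -/
noncomputable def dihedralRep {m : ℕ} (χ : AddChar (ZMod m) ℂ) : FDRep ℂ (DihedralGroup m) :=
  FDRep.of (((Matrix.toLinAlgEquiv' : Matrix (Fin 2) (Fin 2) ℂ ≃ₐ[ℂ] _) :
    Matrix (Fin 2) (Fin 2) ℂ →* ((Fin 2 → ℂ) →ₗ[ℂ] (Fin 2 → ℂ))).comp (dihedralMatrix χ))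

theorem dihedralRep_character {m : ℕ} (χ : AddChar (ZMod m) ℂ) (g : DihedralGroup m) :
    (dihedralRep χ).character g = (dihedralMatrix χ g).trace :=
  Matrix.trace_toLin'_eq _

theorem dihedralRep_det {m : ℕ} (χ : AddChar (ZMod m) ℂ) (g : DihedralGroup m) :
    detRep (dihedralRep χ) g = (dihedralMatrix χ g).det :=
  LinearMap.det_toLin' _

theorem dihedralRep_r {m : ℕ} (χ : AddChar (ZMod m) ℂ) (i : ZMod m) :
    (dihedralRep χ).character (.r i) - 1 - detRep (dihedralRep χ) (.r i) =
      χ i + χ (-i) - 2 := by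
  rw [dihedralRep_character, dihedralRep_det]
  simp [dihedralMatrix, Matrix.trace_fin_two, Matrix.det_fin_two, ← AddChar.map_add_eq_mul]
  ring

theorem dihedralRep_sr {m : ℕ} (χ : AddChar (ZMod m) ℂ) (i : ZMod m) :
    (dihedralRep χ).character (.sr i) - 1 - detRep (dihedralRep χ) (.sr i) = 0 := by
  rw [dihedralRep_character, dihedralRep_det]
  simp [dihedralMatrix, Matrix.trace_fin_two, Matrix.det_fin_two, ← AddChar.map_add_eq_mul]

namespace AffineAction

variable {G : Type} [Group G] {m : ℕ} {X H : Subgroup G} (D : AffineAction m X H)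

/-- The subgroup of `X` acting by maps of the form `v ↦ ± v + b`. -/
def E : Subgroup G := X ⊓ (Subgroup.zpowers (-1)).comap D.φ

theorem mem_E {x : G} : x ∈ D.E ↔ x ∈ X ∧ (D.φ x = 1 ∨ D.φ x = -1) := by
  rw [E, Subgroup.mem_inf, Subgroup.mem_comap]
  refine and_congr_right fun _ => ⟨?_, ?_⟩
  · rintro ⟨k, hk⟩
    rcases Int.even_or_odd k with h | h
    · left; rw [← hk]; exact h.neg_one_zpow
    · right; rw [← hk]; exact h.neg_one_zpow
  · rintro (h | h) <;> rw [h]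
    · exact one_mem _
    · exact Subgroup.mem_zpowers _

theorem C_le_E : D.C ≤ D.E := fun _ hx => D.mem_E.mpr ⟨hx.1, Or.inl (D.mem_C.mp hx).2⟩

theorem T_one [Fintype G] : D.T 1 = indChar D.C 1 := by
  rw [T]
  congr 1

variable [Fact (2 < m)]

theorem units_one_ne_neg_one : (1 : (ZMod m)ˣ) ≠ -1 := by
  intro h
  have := congrArg Units.val h
  rw [Units.val_neg, Units.val_one] at this
  exact ZMod.neg_one_ne_one this.symm

/-- The action of `E` on `ℤ/m` as a homomorphism to a dihedral group. -/
noncomputable def dihedralHom : D.E →* DihedralGroup m where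
  toFun x := if D.φ x = 1 then .r (D.b x) else .sr (-D.b x)
  map_one' := by simp [D.b_one]
  map_mul' := by
    rintro ⟨x, hx⟩ ⟨y, hy⟩
    have hne := units_one_ne_neg_one (m := m)
    have hne' := hne.symm
    rw [mem_E] at hx hy
    simp only [MulMemClass.mk_mul_mk, map_mul, D.b_mul x hx.1 y hy.1]
    rcases hx.2 with h1 | h1 <;> rcases hy.2 with h2 | h2 <;>
      simp [h1, h2, hne'] <;> ring

theorem dihedralHom_surjective {t : G} (ht : t ∈ X) (hφt : D.φ t = -1) :
    Function.Surjective D.dihedralHom := by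
  have : NeZero m := ⟨by have := (Fact.out : 2 < m); omega⟩
  have hne := (units_one_ne_neg_one (m := m)).symm
  rintro (i | i)
  · refine ⟨⟨D.wpow i, D.C_le_E (D.wpow_mem_C i)⟩, ?_⟩
    simp [dihedralHom, (D.mem_C.mp (D.wpow_mem_C i)).2, D.b_wpow]
  · have hw := D.wpow_mem_C (-i - D.b t)
    have h1 : D.φ (D.wpow (-i - D.b t) * t) = -1 := by
      rw [map_mul, (D.mem_C.mp hw).2, hφt, one_mul]
    refine ⟨⟨D.wpow (-i - D.b t) * t, D.mem_E.mpr ⟨X.mul_mem hw.1 ht, Or.inr h1⟩⟩, ?_⟩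
    simp only [dihedralHom, MonoidHom.coe_mk, OneHom.coe_mk, h1, if_neg hne,
      D.b_mul_of_mem_C hw ht, D.b_wpow]
    simp

variable [Fintype G]

theorem card_E {t : G} (ht : t ∈ X) (hφt : D.φ t = -1) :
    (Nat.card D.E : ℂ) = 2 * Nat.card D.C := by
  have hne := (units_one_ne_neg_one (m := m)).symm
  have h1 : (Nat.card D.C : ℂ) = ∑ x : G, if x ∈ X ∧ D.φ x = -1 then 1 else 0 := by
    rw [natCard_eq_sum]
    refine Fintype.sum_equiv (Equiv.mulLeft t) _ _ fun x => ?_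
    simp only [Equiv.coe_mulLeft, X.mul_mem_cancel_left ht, map_mul, hφt, mem_C]
    refine if_congr (and_congr_right fun _ => ?_) rfl rfl
    simp
  rw [two_mul]
  nth_rewrite 2 [h1]
  rw [natCard_eq_sum, natCard_eq_sum D.C, ← Finset.sum_add_distrib]
  refine Finset.sum_congr rfl fun x _ => ?_
  rw [D.mem_E, D.mem_C]
  by_cases hx : x ∈ X
  · by_cases h2 : D.φ x = 1
    · simp [hx, h2, hne.symm]
    · simp [hx, h2]
  · simp [hx]

theorem T_sub_mem_of_neg_one [NeZero m] {t : G} (ht : t ∈ X) (hφt : D.φ t = -1)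
    (htarget : IsTargetGroup (DihedralGroup m)) (χ : AddChar (ZMod m) ℂ) :
    memP G (D.T χ - indChar D.C 1) := by
  have hC : (Nat.card D.C : ℂ) ≠ 0 := by exact_mod_cast Nat.card_pos.ne'
  have hinv : D.T χ⁻¹ = D.T χ := by
    rw [← D.T_mulShift χ ht, hφt, Units.val_neg, Units.val_one]
    congr 1
    ext a
    simp [AddChar.mulShift_apply]
  have hsurj := D.dihedralHom_surjective ht hφt
  have := memP.ind D.E D.dihedralHom.ker (pullRep D.dihedralHom (dihedralRep χ))
    (by
      rw [pullRep_character, Function.comp_apply, map_one, dihedralRep_character, map_one]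
      simp)
    (htarget.of_mulEquiv (QuotientGroup.quotientKerEquivOfSurjective _ hsurj))
    (fun n hn => by
      change (dihedralRep χ).ρ (D.dihedralHom n) = 1
      rw [MonoidHom.mem_ker.mp hn, map_one])
  convert this using 1
  rw [indChar_eq_conjSum D.E _ (D.extC χ + D.extC χ⁻¹ - (2 : ℂ) • D.extC 1)]
  · have h1 : (fun g => if g ∈ D.E then (D.extC χ + D.extC χ⁻¹ - (2 : ℂ) • D.extC 1) g else 0) =
        D.extC χ + D.extC χ⁻¹ - (2 : ℂ) • D.extC 1 := by
      ext g
      split_ifs with h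
      · rfl
      · have h2 : g ∉ D.C := fun h3 => h (D.C_le_E h3)
        simp [extC, h2]
    rw [h1, conjSum_sub, conjSum_add, conjSum_smul, D.conjSum_extC, D.conjSum_extC,
      D.conjSum_extC, hinv, T_one, D.card_E ht hφt]
    ext g
    simp only [Pi.sub_apply, Pi.smul_apply, Pi.add_apply, smul_eq_mul]
    field_simp
    ring
  · rintro ⟨x, hx⟩
    obtain ⟨hxX, hxφ⟩ := D.mem_E.mp hx
    have hne := (units_one_ne_neg_one (m := m)).symm
    rw [pullRep_character, pullRep_det]
    simp only [Pi.sub_apply, Function.comp_apply, Pi.one_apply]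
    rcases hxφ with h | h
    · have h2 : x ∈ D.C := D.mem_C.mpr ⟨hxX, h⟩
      have h3 : D.dihedralHom ⟨x, hx⟩ = .r (D.b x) := if_pos h
      rw [h3, dihedralRep_r]
      simp [extC, h2, AddChar.inv_apply]
    · have h2 : x ∉ D.C := fun h3 => hne (h ▸ (D.mem_C.mp h3).2)
      have h3 : D.dihedralHom ⟨x, hx⟩ = .sr (-D.b x) := if_neg (by simp [h, hne])
      rw [h3, dihedralRep_sr]
      simp [extC, h2]

end AffineAction

/-! ### Sums of induced characters modulo `𝒫` -/

/-- `𝒫_G` as an additive group. -/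
def memPSubgroup (G : Type) [Group G] [Fintype G] : AddSubgroup (G → ℂ) where
  carrier := {f | memP G f}
  add_mem' ha hb := memP.add _ _ ha hb
  zero_mem' := memP.zero
  neg_mem' ha := memP.neg _ ha

theorem conjFun_add {G : Type} (f₁ f₂ : G → ℂ) :
    conjFun (f₁ + f₂) = conjFun f₁ + conjFun f₂ := by
  ext g; simp [conjFun]

theorem conjFun_neg {G : Type} (f : G → ℂ) : conjFun (-f) = -conjFun f := by
  ext g; simp [conjFun]

theorem conjFun_sub {G : Type} (f₁ f₂ : G → ℂ) :
    conjFun (f₁ - f₂) = conjFun f₁ - conjFun f₂ := by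
  ext g; simp [conjFun]

/-- The group of all `τ + τ̄` with `τ` a generalised character of degree `0`. -/
def conjSubgroup (G : Type) [Group G] : AddSubgroup (G → ℂ) where
  carrier := {f | ∃ τ, IsGenChar τ ∧ τ 1 = 0 ∧ f = τ + conjFun τ}
  add_mem' := by
    rintro _ _ ⟨τ₁, h₁, d₁, rfl⟩ ⟨τ₂, h₂, d₂, rfl⟩
    exact ⟨τ₁ + τ₂, h₁.add h₂, by simp [d₁, d₂], by rw [conjFun_add]; abel⟩
  zero_mem' := ⟨0, Submodule.zero_mem _, rfl, by ext; simp [conjFun]⟩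
  neg_mem' := by
    rintro _ ⟨τ, h, d, rfl⟩
    exact ⟨-τ, h.neg, by simp [d], by rw [conjFun_neg]; abel⟩

theorem conjSubgroup_le (G : Type) [Group G] [Fintype G] : conjSubgroup G ≤ memPSubgroup G := by
  rintro _ ⟨τ, h, d, rfl⟩
  exact memP.conj_add τ h d

theorem isPermChar_indChar {G : Type} [Group G] [Fintype G] (H : Subgroup G) :
    IsPermChar (indChar H 1) :=
  Submodule.subset_span ⟨H, rfl⟩

theorem sum_mem_of_involution {A ι : Type} [AddCommGroup A] [Fintype ι] (S : AddSubgroup A)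
    (f : ι → A) (σ : ι → ι) (hσ : ∀ i, σ (σ i) = i) (h₁ : ∀ i, f i + f (σ i) ∈ S)
    (h₂ : ∀ i, σ i = i → f i ∈ S) : ∑ i, f i ∈ S := by
  rw [← QuotientAddGroup.eq_zero_iff]
  change QuotientAddGroup.mk' S _ = 0
  rw [map_sum]
  refine Finset.sum_involution (fun i _ => σ i) (fun i _ => ?_) (fun i _ hi h => hi ?_)
    (fun i _ => Finset.mem_univ _) (fun i _ => hσ i)
  · rw [← map_add]
    exact (QuotientAddGroup.eq_zero_iff _).mpr (h₁ i)
  · exact (QuotientAddGroup.eq_zero_iff _).mpr (h₂ i h)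

namespace AffineAction

variable {G : Type} [Group G] [Fintype G] {m : ℕ} {X H : Subgroup G} (D : AffineAction m X H)

theorem T_add_T_inv_mem [NeZero m] (χ : AddChar (ZMod m) ℂ) :
    (D.T χ - indChar D.C 1) + (D.T χ⁻¹ - indChar D.C 1) ∈ conjSubgroup G := by
  refine ⟨D.T χ - indChar D.C 1, (D.isGenChar_T χ).sub (isGenChar_indChar_one _), ?_, ?_⟩
  · rw [Pi.sub_apply, D.T_apply_one, sub_self]
  · rw [conjFun_sub, D.conjFun_T,
      (isPermChar_indChar D.C).conjFun_eq]

theorem T_apply_of_coprime (χ : AddChar (ZMod m) ℂ) {u : G} {c : ℕ} (hu : u ^ c = 1)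
    (hc : c.Coprime m) : D.T χ u = indChar D.C 1 u := by
  simp only [T, indChar]
  congr 1
  refine Finset.sum_congr rfl fun x _ => ?_
  split_ifs with h
  · have h1 : (x⁻¹ * u * x) ^ c = 1 := by
      have := conj_pow (i := c) (a := x⁻¹) (b := u)
      rw [inv_inv] at this
      rw [this, hu]; simp
    have h2 := D.b_pow_of_mem_C h c
    rw [h1, D.b_one] at h2
    have h3 : IsUnit (c : ZMod m) := (ZMod.isUnit_iff_coprime c m).mpr hc
    rw [(h3.mul_right_eq_zero).mp h2.symm]
    simp
  · rfl

theorem mulShift_neg_eq_inv (χ : AddChar (ZMod m) ℂ) (a : ZMod m) :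
    χ.mulShift (-a) = (χ.mulShift a)⁻¹ := by
  ext b
  simp [AddChar.mulShift_apply, AddChar.inv_apply]

/-- For an odd prime `p`, the generalised character `Ind_H 1 - Ind_X 1 - n Ind_C 1` lies in `𝒫`
and vanishes at all `p`-regular elements. -/
theorem exists_memP_of_odd {p : ℕ} (hp : p.Prime) (hodd : Odd p) (D : AffineAction p X H) :
    ∃ (n : ℕ), indChar H 1 - indChar X 1 - n • indChar D.C 1 ∈ memPSubgroup G ∧
      ∀ (u : G) (c : ℕ), u ^ c = 1 → c.Coprime p →
        (indChar H 1 - indChar X 1 - n • indChar D.C 1) u = 0 := by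
  have : Fact p.Prime := ⟨hp⟩
  have : Fact (2 < p) := ⟨lt_of_le_of_ne hp.two_le (by rintro rfl; exact absurd hodd (by decide))⟩
  let J := (ZMod p)ˣ ⧸ X.map D.φ
  have hsum : indChar H 1 - indChar X 1 - Fintype.card J • indChar D.C 1 =
      ∑ q : J, (D.T (ZMod.stdAddChar.mulShift (q.out : ZMod p)) - indChar D.C 1) := by
    rw [D.indChar_sub_eq_sum_quotient, Finset.sum_sub_distrib, Finset.sum_const, Finset.card_univ]
  refine ⟨Fintype.card J, ?_, fun u c hu hc => ?_⟩
  · rw [hsum]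
    have hneg : ∀ q : J, D.T (ZMod.stdAddChar.mulShift
        (((QuotientGroup.mk (-1) : J) * q).out : ZMod p)) =
        D.T (ZMod.stdAddChar.mulShift (q.out : ZMod p))⁻¹ := by
      intro q
      rw [D.T_eq_of_mk_eq (v := -q.out), Units.val_neg, mulShift_neg_eq_inv]
      rw [QuotientGroup.out_eq', ← neg_one_mul q.out, QuotientGroup.mk_mul, QuotientGroup.out_eq']
    refine sum_mem_of_involution _ _ (fun q => (QuotientGroup.mk (-1) : J) * q) (fun q => ?_)
      (fun q => ?_) (fun q hq => ?_)
    · rw [← mul_assoc, ← QuotientGroup.mk_mul]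
      simp
    · rw [hneg]
      exact conjSubgroup_le G (D.T_add_T_inv_mem _)
    · have h1 : (QuotientGroup.mk (-1) : J) = 1 := mul_eq_right.mp hq
      obtain ⟨t, ht, hφt⟩ := (QuotientGroup.eq_one_iff _).mp h1
      exact D.T_sub_mem_of_neg_one ht hφt
        (Or.inr (Or.inr ⟨p, hodd, hp, ⟨MulEquiv.refl _⟩⟩)) _
  · rw [hsum, Finset.sum_apply]
    refine Finset.sum_eq_zero fun q _ => ?_
    rw [Pi.sub_apply, D.T_apply_of_coprime _ hu hc, sub_self]

/-- An element `w` generating a normal subgroup gives rise to an affine action of `⟨w⟩ H` on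
`⟨w⟩ / (⟨w⟩ ∩ H)`. -/
theorem exists_of_conj {G : Type} [Group G] (m : ℕ) (w : G) (H : Subgroup G)
    (hw : ∀ i : ℤ, w ^ i ∈ H ↔ (m : ℤ) ∣ i) (hconj : ∀ x, ∃ j : ℤ, x * w * x⁻¹ = w ^ j) :
    ∃ D : AffineAction m (Subgroup.zpowers w ⊔ H) H,
      D.w = w ∧ ∀ x, x * w * x⁻¹ = w → D.φ x = 1 := by
  choose j hj using hconj
  have hval : ∀ i k : ℤ, ∀ h ∈ H, ∀ h' ∈ H, w ^ i * h = w ^ k * h' → (i : ZMod m) = k := by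
    intro i k h hh h' hh' e
    rw [ZMod.intCast_eq_intCast_iff_dvd_sub, ← hw, sub_eq_neg_add, zpow_add, zpow_neg]
    have : (w ^ i)⁻¹ * w ^ k = h * h'⁻¹ := by
      rw [inv_mul_eq_iff_eq_mul, ← mul_assoc, e, mul_inv_cancel_right]
    rw [this]
    exact H.mul_mem hh (H.inv_mem hh')
  have hval' : ∀ i k : ℤ, w ^ i = w ^ k → (i : ZMod m) = k := fun i k e =>
    hval i k 1 H.one_mem 1 H.one_mem (by rw [e])
  have hconjz : ∀ x (k : ℤ), x * w ^ k * x⁻¹ = w ^ (j x * k) := fun x k => by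
    rw [← conj_zpow, hj, zpow_mul]
  let φ₀ : G →* ZMod m :=
    { toFun := fun x => (j x : ZMod m)
      map_one' := by
        have := hval' (j 1) 1 (by rw [← hj]; simp)
        simpa using this
      map_mul' := fun x y => by
        rw [← Int.cast_mul]
        refine hval' _ _ ?_
        rw [← hj, ← hconjz, ← hj]
        group }
  have hφ : ∀ x, (φ₀.toHomUnits x : ZMod m) = j x := fun x => rfl
  have hφw : φ₀.toHomUnits w = 1 := by
    ext
    rw [hφ, Units.val_one, ← Int.cast_one]
    exact hval' _ _ (by rw [← hj]; simp)
  have hnormal : (Subgroup.zpowers w).Normal := by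
    refine ⟨?_⟩
    rintro _ ⟨k, rfl⟩ x
    exact ⟨j x * k, (hconjz x k).symm⟩
  have hX : ∀ x, x ∈ Subgroup.zpowers w ⊔ H ↔ ∃ i : ℤ, ∃ h ∈ H, w ^ i * h = x := by
    intro x
    rw [Subgroup.mem_sup_of_normal_left]
    constructor
    · rintro ⟨_, ⟨i, rfl⟩, h, hh, rfl⟩
      exact ⟨i, h, hh, rfl⟩
    · rintro ⟨i, h, hh, rfl⟩
      exact ⟨_, ⟨i, rfl⟩, h, hh, rfl⟩
  let b : G → ZMod m := fun x =>
    if hx : ∃ i : ℤ, ∃ h ∈ H, w ^ i * h = x then (hx.choose : ZMod m) else 0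
  have hb : ∀ i : ℤ, ∀ h ∈ H, b (w ^ i * h) = i := by
    intro i h hh
    have hx : ∃ k : ℤ, ∃ h' ∈ H, w ^ k * h' = w ^ i * h := ⟨i, h, hh, rfl⟩
    have h1 : b (w ^ i * h) = (hx.choose : ZMod m) := dif_pos hx
    obtain ⟨h', hh', e⟩ := hx.choose_spec
    rw [h1]
    exact hval _ _ h' hh' h hh e
  refine ⟨{
    φ := φ₀.toHomUnits
    b := b
    b_mul := ?_
    w := w
    w_mem := Subgroup.mem_sup_left (Subgroup.mem_zpowers w)
    b_w := by simpa using hb 1 1 H.one_mem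
    φ_w := hφw
    mem_iff := ?_ }, rfl, ?_⟩
  · intro x hx y hy
    obtain ⟨i, h, hh, rfl⟩ := (hX x).mp hx
    obtain ⟨k, h', hh', rfl⟩ := (hX y).mp hy
    have h1 : w ^ i * h * (w ^ k * h') = w ^ (i + j h * k) * (h * h') := by
      rw [zpow_add, ← hconjz]
      group
    rw [h1, hb _ _ (H.mul_mem hh hh'), hb i h hh, hb k h' hh', map_mul, map_zpow, hφw, one_zpow,
      one_mul, hφ]
    push_cast
    ring
  · intro x
    constructor
    · intro hx
      exact ⟨Subgroup.mem_sup_right hx, by simpa using hb 0 x hx⟩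
    · rintro ⟨hx, hbx⟩
      obtain ⟨i, h, hh, rfl⟩ := (hX x).mp hx
      rw [hb i h hh, ZMod.intCast_zmod_eq_zero_iff_dvd, ← hw] at hbx
      exact H.mul_mem hbx hh
  · intro x hx
    ext
    change (j x : ZMod m) = 1
    rw [← Int.cast_one]
    exact hval' _ _ (by rw [← hj, hx, zpow_one])

end AffineAction

/-! ### Permutation characters of split extensions -/

theorem indChar_eq_comp_of_ker_le {G Q : Type} [Group G] [Fintype G] [Group Q] [Fintype Q]
    (π : G →* Q) (hπ : Function.Surjective π) (K : Subgroup G) (hK : π.ker ≤ K) :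
    indChar K 1 = indChar (K.map π) 1 ∘ π := by
  have h := indChar_comap π hπ (K.map π) 1
  rw [← h]
  exact (congrArg (fun L : Subgroup G => indChar L 1) (Subgroup.comap_map_eq_self hK)).symm

theorem exists_zpow_eq_conj {G : Type} [Group G] (N : Subgroup G) [N.Normal] [IsCyclic N]
    {w : G} (hw : w ∈ N) (x : G) : ∃ j : ℤ, x * w * x⁻¹ = w ^ j := by
  obtain ⟨j, hj⟩ := MonoidHom.map_cyclic (MulAut.conjNormal (H := N) x).toMonoidHom
  refine ⟨j, ?_⟩
  have := congrArg Subtype.val (hj ⟨w, hw⟩)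
  simpa using this

theorem exists_pow_prime_mem {G : Type} [Group G] {p : ℕ} (N H : Subgroup G) (hN : IsPGroup p N)
    (h : ¬ N ≤ H) : ∃ w ∈ N, w ∉ H ∧ w ^ p ∈ H := by
  obtain ⟨n, hn, hnH⟩ := SetLike.not_le_iff_exists.mp h
  have hex : ∃ k, n ^ p ^ k ∈ H := by
    obtain ⟨k, hk⟩ := hN ⟨n, hn⟩
    have := congrArg Subtype.val hk
    simp only [Subgroup.coe_pow, Subgroup.coe_one] at this
    exact ⟨k, this ▸ H.one_mem⟩
  have hpos : Nat.find hex ≠ 0 := fun h0 => hnH (by simpa [h0] using Nat.find_spec hex)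
  refine ⟨n ^ p ^ (Nat.find hex - 1), N.pow_mem hn _, Nat.find_min hex (by omega), ?_⟩
  rw [← pow_mul, ← pow_succ, Nat.sub_add_cancel (Nat.one_le_iff_ne_zero.mpr hpos)]
  exact Nat.find_spec hex

theorem zpow_mem_iff_dvd_of_prime {G : Type} [Group G] {p : ℕ} (hp : p.Prime) (H : Subgroup G)
    {w : G} (hw : w ∉ H) (hwp : w ^ p ∈ H) (i : ℤ) : w ^ i ∈ H ↔ (p : ℤ) ∣ i := by
  constructor
  · intro hi
    by_contra hdvd
    obtain ⟨a, b, hab⟩ := (Nat.prime_iff_prime_int.mp hp).coprime_iff_not_dvd.mpr hdvd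
    apply hw
    rw [← zpow_one w, ← hab, zpow_add, mul_comm a _, mul_comm b _, zpow_mul, zpow_mul, zpow_natCast]
    exact H.mul_mem (H.zpow_mem hwp _) (H.zpow_mem hi _)
  · rintro ⟨k, rfl⟩
    rw [zpow_mul, zpow_natCast]
    exact H.zpow_mem hwp k

theorem indChar_split_of_odd {G Q : Type} [Group G] [Fintype G] [Group Q] [Fintype Q]
    (π : G →* Q) (s : Q →* G) (hs : ∀ q, π (s q) = q) {p c : ℕ} (hp : p.Prime) (hodd : Odd p)
    (hker : IsPGroup p π.ker) [IsCyclic π.ker] (hc : c.Coprime p) (hsc : ∀ q, s q ^ c = 1)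
    (H : Subgroup G) :
    IsPermChar (indChar H 1 ∘ s) ∧ indChar H 1 - indChar H 1 ∘ s ∘ π ∈ memPSubgroup G := by
  have hπ : Function.Surjective π := fun q => ⟨s q, hs q⟩
  induction hM : H ⊓ π.ker using WellFoundedGT.induction generalizing H with
  | ind M ih =>
    subst hM
    by_cases hle : π.ker ≤ H
    · rw [indChar_eq_comp_of_ker_le π hπ H hle]
      have h1 : (indChar (H.map π) 1 ∘ π) ∘ s = indChar (H.map π) 1 := by
        ext q; simp [hs]
      refine ⟨by rw [h1]; exact isPermChar_indChar _, ?_⟩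
      rw [← Function.comp_assoc, h1, sub_self]
      exact zero_mem _
    · obtain ⟨w, hwN, hwH, hwp⟩ := exists_pow_prime_mem π.ker H hker hle
      obtain ⟨D, hDw, hDφ⟩ := AffineAction.exists_of_conj p w H
        (zpow_mem_iff_dvd_of_prime hp H hwH hwp) (exists_zpow_eq_conj π.ker hwN)
      obtain ⟨n, hA, hvan⟩ := AffineAction.exists_memP_of_odd hp hodd D
      have hlt : ∀ K : Subgroup G, w ∈ K → H ⊓ π.ker ≤ K → K ⊓ π.ker > H ⊓ π.ker := by
        intro K hwK hK
        refine lt_of_le_of_ne (le_inf hK inf_le_right) fun e => hwH ?_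
        exact (e ▸ (⟨hwK, hwN⟩ : w ∈ K ⊓ π.ker) : w ∈ H ⊓ π.ker).1
      have hwC : w ∈ D.C := by
        have := D.w_mem_C
        rwa [hDw] at this
      have hX := ih _ (hlt _ (Subgroup.mem_sup_left (Subgroup.mem_zpowers w)) (inf_le_left.trans le_sup_right)) _ rfl
      have hC := ih _ (hlt D.C hwC fun x hx => D.mem_C.mpr
        ⟨(le_sup_right : H ≤ Subgroup.zpowers w ⊔ H) hx.1, hDφ x (by
          have := (IsCyclic.isMulCommutative (α := π.ker)).is_comm.comm ⟨x, hx.2⟩ ⟨w, hwN⟩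
          rw [mul_inv_eq_iff_eq_mul]
          exact congrArg Subtype.val this)⟩) _ rfl
      have hval : ∀ q, indChar H 1 (s q) =
          indChar (Subgroup.zpowers w ⊔ H) 1 (s q) + n • indChar D.C 1 (s q) := by
        intro q
        have := hvan (s q) c (hsc q) hc
        simp only [Pi.sub_apply, Pi.smul_apply] at this
        rw [sub_sub, sub_eq_zero] at this
        exact this
      constructor
      · have : indChar H 1 ∘ s =
            indChar (Subgroup.zpowers w ⊔ H) 1 ∘ s + n • (indChar D.C 1 ∘ s) := by
          ext q; exact hval q
        rw [this]
        exact Submodule.add_mem _ hX.1 (nsmul_mem hC.1 n)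
      · have : indChar H 1 - indChar H 1 ∘ s ∘ π =
            (indChar H 1 - indChar (Subgroup.zpowers w ⊔ H) 1 - n • indChar D.C 1) +
            (indChar (Subgroup.zpowers w ⊔ H) 1 - indChar (Subgroup.zpowers w ⊔ H) 1 ∘ s ∘ π) +
            n • (indChar D.C 1 - indChar D.C 1 ∘ s ∘ π) := by
          ext g
          have := hval (π g)
          simp only [Pi.sub_apply, Pi.smul_apply, Pi.add_apply, Function.comp_apply, this]
          simp only [nsmul_eq_mul]
          ring
        rw [this]
        exact add_mem (add_mem hA hX.2) (nsmul_mem hC.2 n)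

theorem SG_subset_PG_of_odd {G Q : Type} [Group G] [Fintype G] [Group Q] [Fintype Q]
    (π : G →* Q) (s : Q →* G) (hs : ∀ q, π (s q) = q) {p c : ℕ} (hp : p.Prime) (hodd : Odd p)
    (hker : IsPGroup p π.ker) [IsCyclic π.ker] (hc : c.Coprime p) (hsc : ∀ q, s q ^ c = 1)
    (h : SG Q ⊆ PG Q) : SG G ⊆ PG G := by
  rintro f ⟨hperm, hdeg, hdet⟩
  have key : IsPermChar (f ∘ s) ∧ f - f ∘ s ∘ π ∈ memPSubgroup G := by
    clear hdeg hdet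
    induction hperm using Submodule.span_induction with
    | mem x hx =>
      obtain ⟨H, rfl⟩ := hx
      exact indChar_split_of_odd π s hs hp hodd hker hc hsc H
    | zero => exact ⟨Submodule.zero_mem _, by simp⟩
    | add x y _ _ hx hy =>
      refine ⟨Submodule.add_mem _ hx.1 hy.1, ?_⟩
      rw [show x + y - (x + y) ∘ s ∘ π = (x - x ∘ s ∘ π) + (y - y ∘ s ∘ π) by
        ext g; simp; ring]
      exact add_mem hx.2 hy.2
    | smul a x _ hx =>
      refine ⟨Submodule.smul_mem _ a hx.1, ?_⟩
      rw [show a • x - (a • x) ∘ s ∘ π = a • (x - x ∘ s ∘ π) by ext g; simp; ring]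
      exact zsmul_mem hx.2 a
  have h1 : f ∘ s ∈ PG Q := h ⟨key.1, by simp [hdeg], hdet.comp s⟩
  have h2 : memP G (f ∘ s ∘ π) := memP.comp π (fun q => ⟨s q, hs q⟩) h1
  have h3 := memP.add _ _ key.2 h2
  rwa [sub_add_cancel] at h3

/-! ### Groups of odd order and determinants -/

theorem comp_mem_conjSubgroup {G Q : Type} [Group G] [Group Q] (π : G →* Q) {f : Q → ℂ}
    (hf : f ∈ conjSubgroup Q) : f ∘ π ∈ conjSubgroup G := by
  obtain ⟨τ, h, d, rfl⟩ := hf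
  exact ⟨τ ∘ π, h.comp π, by simp [d], rfl⟩

theorem IsTargetGroup.even_card {Q : Type} [Group Q] (h : IsTargetGroup Q) :
    Even (Nat.card Q) := by
  rcases h with ⟨⟨i⟩⟩ | ⟨⟨i⟩⟩ | ⟨p, -, -, ⟨i⟩⟩
  · rw [Nat.card_congr i.toEquiv]
    simp
    decide
  · rw [Nat.card_congr i.toEquiv, DihedralGroup.nat_card]
    exact even_two_mul 4
  · rw [Nat.card_congr i.toEquiv, DihedralGroup.nat_card]
    exact even_two_mul p

theorem memP.mem_conjSubgroup_of_odd {Q : Type} [Group Q] [Fintype Q] (hQ : Odd (Nat.card Q))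
    {f : Q → ℂ} (hf : memP Q f) : f ∈ conjSubgroup Q := by
  induction hf with
  | conj_add τ hτ hdeg => exact ⟨τ, hτ, hdeg, rfl⟩
  | ind H N V hdeg htarget hfactors =>
    refine absurd ?_ (Nat.not_even_iff_odd.mpr hQ)
    have h1 : Nat.card (H ⧸ N) ∣ Nat.card Q :=
      (N.card_quotient_dvd_card).trans H.card_subgroup_dvd_card
    exact even_iff_two_dvd.mpr ((even_iff_two_dvd.mp htarget.even_card).trans h1)
  | zero => exact zero_mem _
  | add f₁ f₂ _ _ h₁ h₂ => exact add_mem h₁ h₂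
  | neg f _ h => exact neg_mem h

theorem conj_sum_map_pow (S : Multiset ℂ) (k : ℕ) :
    ((S.map (starRingEnd ℂ)).map (· ^ k)).sum = starRingEnd ℂ (S.map (· ^ k)).sum := by
  rw [map_multiset_sum, Multiset.map_map, Multiset.map_map]
  simp

theorem conj_prod_map (S : Multiset ℂ) :
    (S.map (starRingEnd ℂ)).prod = starRingEnd ℂ S.prod :=
  (map_multiset_prod _ _).symm

theorem detRep_mul_conj_self {G : Type} [Group G] [Finite G] (V : FDRep ℂ G) (g : G) :
    detRep V g * starRingEnd ℂ (detRep V g) = 1 := by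
  rw [Complex.mul_conj', norm_detRep]
  simp

theorem detRep_mul_conj_eq_one_of_odd {G : Type} [Group G] [Finite G] (hG : Odd (Nat.card G))
    (V W : FDRep ℂ G) (hreal : conjFun (V.character - W.character) = V.character - W.character)
    (g : G) : detRep V g * starRingEnd ℂ (detRep W g) = 1 := by
  obtain ⟨S, -, hSd, hS⟩ := exists_eigenvalues V g
  obtain ⟨T, -, hTd, hT⟩ := exists_eigenvalues W g
  have h1 : S + T.map (starRingEnd ℂ) = S.map (starRingEnd ℂ) + T := by
    refine multiset_eq_of_powerSums _ _ fun k => ?_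
    rw [Multiset.map_add, Multiset.map_add, Multiset.sum_add, Multiset.sum_add,
      conj_sum_map_pow, conj_sum_map_pow, ← hS, ← hT]
    have := congrFun hreal (g ^ k)
    simp only [conjFun, Pi.sub_apply, map_sub] at this
    linear_combination -this
  have h2 := congrArg Multiset.prod h1
  rw [Multiset.prod_add, Multiset.prod_add, conj_prod_map, conj_prod_map, ← hSd, ← hTd] at h2
  set y := detRep V g * starRingEnd ℂ (detRep W g) with hy
  have hyy : y ^ 2 = 1 := by
    rw [pow_two]
    nth_rewrite 2 [h2]
    have h3 := detRep_mul_conj_self V g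
    have h4 := detRep_mul_conj_self W g
    rw [hy]
    linear_combination (detRep W g * starRingEnd ℂ (detRep W g)) * h3 + h4
  have hyc : y ^ Nat.card G = 1 := by
    have h5 : ∀ U : FDRep ℂ G, detRep U g ^ Nat.card G = 1 := fun U => by
      rw [← detRep_pow, pow_card_eq_one', detRep, map_one]
      exact LinearMap.det_id
    rw [hy, mul_pow, ← map_pow, h5, h5]
    simp
  obtain ⟨k, hk⟩ := hG
  rw [hk, pow_succ, pow_mul, hyy, one_pow, one_mul] at hyc
  exact hyc

theorem IsPermChar.sub_degree_mem_SG {Q : Type} [Group Q] [Fintype Q] (hQ : Odd (Nat.card Q))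
    {α : Q → ℂ} (hα : IsPermChar α) {x : ℤ} (hx : α 1 = x) : α - x • 1 ∈ SG Q := by
  have hp : IsPermChar (α - x • 1) :=
    Submodule.sub_mem _ hα (Submodule.smul_mem _ x (isPermChar_one Q))
  refine ⟨hp, by simp [hx], ?_⟩
  obtain ⟨V, W, hVW⟩ := (isGenChar_iff _).mp hp.isGenChar
  exact ⟨V, W, hVW, detRep_mul_conj_eq_one_of_odd hQ V W (hVW ▸ hp.conjFun_eq)⟩

theorem HasTrivialDet.even_of_eq {G : Type} [Group G] [Finite G] {f : G → ℂ}
    (hf : HasTrivialDet f) (ε : G →* ℂ) {z : G} (hz : ε z = -1) (x : ℤ) {τ : G → ℂ}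
    (hτ : IsGenChar τ) (h : ∀ g, f g = x * (ε g - 1) + (τ + conjFun τ) g) : Even x := by
  obtain ⟨V, W, rfl, hdet⟩ := hf
  obtain ⟨U₁, U₂, rfl⟩ := (isGenChar_iff _).mp hτ
  obtain ⟨S, -, hSd, hS⟩ := exists_eigenvalues V z
  obtain ⟨T, -, hTd, hT⟩ := exists_eigenvalues W z
  obtain ⟨A, -, hAd, hA⟩ := exists_eigenvalues U₁ z
  obtain ⟨B, -, hBd, hB⟩ := exists_eigenvalues U₂ z
  obtain ⟨a, b, rfl⟩ : ∃ a b : ℕ, x = a - b :=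
    ⟨x.toNat, (-x).toNat, (Int.toNat_sub_toNat_neg x).symm⟩
  have h1 : S + Multiset.replicate a 1 + Multiset.replicate b (-1) + B + B.map (starRingEnd ℂ) =
      T + Multiset.replicate a (-1) + Multiset.replicate b 1 + A + A.map (starRingEnd ℂ) := by
    refine multiset_eq_of_powerSums _ _ fun k => ?_
    have := h (z ^ k)
    simp only [Pi.sub_apply, Pi.add_apply, conjFun, map_pow, hz, map_sub] at this
    simp only [Multiset.map_add, Multiset.sum_add, conj_sum_map_pow, ← hS, ← hT, ← hA, ← hB,
      Multiset.map_replicate, Multiset.sum_replicate, one_pow, nsmul_eq_mul]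
    push_cast at this
    linear_combination this
  have h2 := congrArg Multiset.prod h1
  simp only [Multiset.prod_add, conj_prod_map, ← hSd, ← hTd, ← hAd, ← hBd,
    Multiset.prod_replicate, one_pow, mul_one] at h2
  have h3 : detRep V z = detRep W z := by
    have h4 := detRep_mul_conj_self W z
    linear_combination (detRep W z) * hdet z - detRep V z * h4
  have h5 : (-1 : ℂ) ^ b = (-1) ^ a := by
    have hV := detRep_mul_conj_self V z
    have hA' := detRep_mul_conj_self U₁ z
    have hB' := detRep_mul_conj_self U₂ z
    have hV0 : detRep V z ≠ 0 := fun h0 => by simp [h0] at hV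
    rw [mul_assoc _ (detRep U₂ z), mul_assoc _ (detRep U₁ z), hA', hB', mul_one, mul_one,
      ← h3] at h2
    exact mul_left_cancel₀ hV0 h2
  rw [Int.even_sub, Int.even_coe_nat, Int.even_coe_nat]
  rcases Nat.even_or_odd a with ha | ha <;> rcases Nat.even_or_odd b with hb | hb
  · exact iff_of_true ha hb
  · rw [ha.neg_one_pow, hb.neg_one_pow] at h5; norm_num at h5
  · rw [ha.neg_one_pow, hb.neg_one_pow] at h5; norm_num at h5
  · exact iff_of_false (Nat.not_even_iff_odd.mpr ha) (Nat.not_even_iff_odd.mpr hb)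

/-! ### Split extensions of groups of odd order by central cyclic `2`-groups -/

theorem AffineAction.T_eq_linear_mul {G : Type} [Group G] [Fintype G] {m : ℕ} {X H : Subgroup G}
    (D : AffineAction m X H) (χ : AddChar (ZMod m) ℂ) (ε : G →* ℂ)
    (h : ∀ y ∈ D.C, χ (D.b y) = ε y) (g : G) : D.T χ g = ε g * indChar D.C 1 g := by
  simp only [AffineAction.T, indChar]
  rw [mul_left_comm, Finset.mul_sum (a := ε g)]
  congr 1
  refine Finset.sum_congr (M := ℂ) rfl fun x _ => ?_
  split_ifs with hx
  · rw [h _ hx, map_mul, map_mul, mul_right_comm, ← map_mul, inv_mul_cancel, map_one, one_mul,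
      Pi.one_apply, mul_one]
  · rw [mul_zero]

/-- A section of an extension by a central cyclic group of even order yields a sign character
that is nontrivial on a generator of the kernel. -/
theorem exists_sign_of_section {G Q : Type} [Group G] [Group Q] (π : G →* Q) (s : Q →* G)
    (hs : ∀ q, π (s q) = q) {z : G} (hz : π.ker = Subgroup.zpowers z)
    (hcomm : ∀ x, x * z * x⁻¹ = z) (heven : Even (orderOf z)) (hord : orderOf z ≠ 0) :
    ∃ ε : G →* ℂ, ε z = -1 ∧ ∀ g, ε g ^ 2 = 1 := by
  have : NeZero (orderOf z) := ⟨hord⟩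
  obtain ⟨D, hDw, hDφ⟩ := AffineAction.exists_of_conj (orderOf z) z s.range (fun i => by
    rw [orderOf_dvd_iff_zpow_eq_one]
    constructor
    · rintro ⟨q, hq⟩
      have h1 : π (z ^ i) = 1 := by
        rw [← MonoidHom.mem_ker, hz]
        exact ⟨i, rfl⟩
      rw [← hq, hs] at h1
      rw [← hq, h1, map_one]
    · intro h
      rw [h]
      exact one_mem _) (fun x => ⟨1, by rw [hcomm, zpow_one]⟩)
  have hC : ∀ x, x ∈ D.C := fun x => by
    refine D.mem_C.mpr ⟨?_, hDφ x (hcomm x)⟩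
    rw [← inv_mul_cancel_right x (s (π x))]
    refine mul_mem (Subgroup.mem_sup_left ?_) (Subgroup.mem_sup_right ⟨π x, rfl⟩)
    rw [← hz, MonoidHom.mem_ker, map_mul, map_inv, hs, mul_inv_cancel]
  let χ : AddChar (ZMod (orderOf z)) ℂ := AddChar.zmodChar (orderOf z) heven.neg_one_pow
  have h1 : χ 1 = -1 := by
    have := AddChar.zmodChar_apply' (heven.neg_one_pow (α := ℂ)) 1
    simpa using this
  refine ⟨{
    toFun := fun g => χ (D.b g)
    map_one' := by rw [D.b_one, AddChar.map_zero_eq_one]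
    map_mul' := fun x y => by
      rw [D.b_mul_of_mem_C (hC x) (hC y).1, AddChar.map_add_eq_mul] }, ?_, fun g => ?_⟩
  · change χ (D.b z) = -1
    rw [show D.b z = 1 from (congrArg D.b hDw).symm.trans D.b_w, h1]
  · change χ (D.b g) ^ 2 = 1
    rw [AddChar.zmodChar_apply, ← pow_mul, mul_comm, pow_mul, neg_one_sq, one_pow]

theorem indChar_split_of_two {G Q : Type} [Group G] [Fintype G] [Group Q] [Fintype Q]
    (π : G →* Q) (s : Q →* G) (hs : ∀ q, π (s q) = q) {z : G} (hz : π.ker = Subgroup.zpowers z)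
    (hcomm : ∀ x, x * z * x⁻¹ = z) {k : ℕ} (hord : orderOf z = 2 ^ k) (hQ : Odd (Nat.card Q))
    (ε : G →* ℂ) (hεz : ε z = -1) (hε : ∀ g, ε g ^ 2 = 1) (H : Subgroup G) :
    IsPermChar (indChar H 1 ∘ s) ∧ ∃ α, IsPermChar α ∧
      indChar H 1 - indChar H 1 ∘ s ∘ π - (fun g => ε g - 1) * (α ∘ π) ∈ conjSubgroup G := by
  have hπ : Function.Surjective π := fun q => ⟨s q, hs q⟩
  obtain ⟨m, hm⟩ : ∃ m : ℕ, ∀ i : ℤ, z ^ i ∈ H ↔ (m : ℤ) ∣ i := by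
    refine ⟨Function.minimalPeriod (z • ·) ((1 : G) : G ⧸ H), fun i => ?_⟩
    rw [← MulAction.zpow_smul_eq_iff_minimalPeriod_dvd, MulAction.Quotient.smul_mk, eq_comm,
      QuotientGroup.eq]
    simp
  have hmdvd : m ∣ 2 ^ k := by
    rw [← Int.natCast_dvd_natCast, ← hm, zpow_natCast, ← hord, pow_orderOf_eq_one]
    exact one_mem _
  have : NeZero m := ⟨fun h0 => by simp [h0] at hmdvd⟩
  have hcop : (Nat.card Q).Coprime m :=
    Nat.Coprime.coprime_dvd_right hmdvd (hQ.coprime_two_right.pow_right k)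
  obtain ⟨D, hDw, hDφ⟩ := AffineAction.exists_of_conj m z H hm
    (fun x => ⟨1, by rw [hcomm, zpow_one]⟩)
  have hsum := D.indChar_eq_sum_of_le_ker fun x _ => hDφ x (hcomm x)
  have hker : π.ker ≤ D.C := by
    have := D.w_mem_C
    rw [hDw, ← Subgroup.zpowers_le] at this
    exact hz.le.trans this
  set β := indChar (D.C.map π) 1 with hβ
  have hβπ : indChar D.C 1 = β ∘ π := indChar_eq_comp_of_ker_le π hπ D.C hker
  have hperm : indChar H 1 ∘ s = m • β := by
    ext q
    have h1 : s q ^ Nat.card Q = 1 := by rw [← map_pow, pow_card_eq_one', map_one]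
    rw [Function.comp_apply, hsum, Finset.sum_apply]
    simp only [D.T_apply_of_coprime _ h1 hcop, hβπ, Function.comp_apply, hs, Finset.sum_const,
      Finset.card_univ, ZMod.card, Pi.smul_apply]
  refine ⟨hperm ▸ nsmul_mem (isPermChar_indChar _) m, ?_⟩
  have hdiff : indChar H 1 - indChar H 1 ∘ s ∘ π =
      ∑ a : ZMod m, (D.T (ZMod.stdAddChar.mulShift a) - indChar D.C 1) := by
    rw [Finset.sum_sub_distrib, ← hsum, ← Function.comp_assoc, hperm, hβπ, Finset.sum_const,
      Finset.card_univ, ZMod.card]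
    rfl
  let S : AddSubgroup (G → ℂ) :=
    { carrier := {f | ∃ α, IsPermChar α ∧ f - (fun g => ε g - 1) * (α ∘ π) ∈ conjSubgroup G}
      add_mem' := by
        rintro f₁ f₂ ⟨α₁, h₁, c₁⟩ ⟨α₂, h₂, c₂⟩
        refine ⟨α₁ + α₂, Submodule.add_mem _ h₁ h₂, ?_⟩
        convert add_mem c₁ c₂ using 1
        ext g; simp; ring
      zero_mem' := ⟨0, Submodule.zero_mem _, by
        convert zero_mem (conjSubgroup G) using 1
        ext g; simp⟩
      neg_mem' := by
        rintro f ⟨α, h, c⟩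
        refine ⟨-α, Submodule.neg_mem _ h, ?_⟩
        convert neg_mem c using 1
        ext g; simp; ring }
  have hcS : conjSubgroup G ≤ S := fun f hf => ⟨0, Submodule.zero_mem _, by
    convert hf using 1
    ext g; simp⟩
  rw [hdiff]
  refine sum_mem_of_involution S _ (fun a => -a) neg_neg (fun a => ?_) (fun a ha => ?_)
  · rw [AffineAction.mulShift_neg_eq_inv]
    exact hcS (D.T_add_T_inv_mem _)
  · by_cases ha0 : a = 0
    · rw [ha0, AddChar.mulShift_zero, D.T_one, sub_self]
      exact zero_mem _
    set χ := (ZMod.stdAddChar (N := m)).mulShift a with hχ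
    have hχ1 : χ ≠ 1 := ZMod.isPrimitive_stdAddChar m ha0
    have hχz : χ 1 = -1 := by
      have h1 : χ 1 * χ 1 = 1 := by
        have : χ⁻¹ = χ := by rw [hχ, ← AffineAction.mulShift_neg_eq_inv, ha]
        nth_rewrite 1 [← this]
        rw [← AddChar.mul_apply, inv_mul_cancel, AddChar.one_apply]
      refine (mul_self_eq_one_iff.mp h1).resolve_left fun h2 => hχ1 ?_
      ext b
      rw [← ZMod.natCast_zmod_val b, ← nsmul_one, AddChar.map_nsmul_eq_pow, h2, one_pow,
        AddChar.one_apply]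
    have hmeven : Even m := by
      by_contra hodd
      have h1 : χ 1 ^ m = 1 := by
        rw [← AddChar.map_nsmul_eq_pow, nsmul_one, ZMod.natCast_self, AddChar.map_zero_eq_one]
      rw [hχz, (Nat.not_even_iff_odd.mp hodd).neg_one_pow] at h1
      norm_num at h1
    have hεH : ∀ h ∈ H, ε h = 1 := by
      intro h hh
      have h1 : h ^ Nat.card Q ∈ π.ker := by rw [MonoidHom.mem_ker, map_pow, pow_card_eq_one']
      rw [hz] at h1
      obtain ⟨j, hj⟩ := h1
      have h2 : (m : ℤ) ∣ j := (hm j).mp (by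
        have := H.pow_mem hh (Nat.card Q)
        rwa [← hj] at this)
      obtain ⟨l, hl⟩ := hmeven
      obtain ⟨i, rfl⟩ := h2
      have h3 : ε h ^ Nat.card Q = 1 := by
        rw [← map_pow, ← hj]
        have h5 : z ^ m ∈ ε.ker := by
          rw [MonoidHom.mem_ker, map_pow, hεz, Even.neg_one_pow ⟨l, hl⟩]
        have h6 := ε.ker.zpow_mem h5 i
        rwa [← zpow_natCast, ← zpow_mul] at h6
      obtain ⟨n, hn⟩ := hQ
      rw [hn, pow_succ, pow_mul, hε, one_pow, one_mul] at h3
      exact h3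
    have hC : ∀ y ∈ D.C, χ (D.b y) = ε y := by
      intro y hy
      have h1 : (D.wpow (D.b y))⁻¹ * y ∈ H := by
        rw [D.mem_iff]
        have hw := D.C.inv_mem (D.wpow_mem_C (D.b y))
        refine ⟨mul_mem hw.1 hy.1, ?_⟩
        rw [D.b_mul_of_mem_C hw hy.1, D.b_inv (D.wpow_mem_C _).1, D.b_wpow,
          (D.mem_C.mp (D.wpow_mem_C _)).2]
        simp
      have h2 : ε y = ε (D.wpow (D.b y)) := by
        rw [← mul_inv_cancel_left (D.wpow (D.b y)) y, map_mul, hεH _ h1, mul_one]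
        simp
      rw [h2, AffineAction.wpow, hDw, map_pow, hεz, ← hχz, ← AddChar.map_nsmul_eq_pow, nsmul_one,
        ZMod.natCast_zmod_val]
    refine ⟨β, isPermChar_indChar _, ?_⟩
    convert zero_mem (conjSubgroup G) using 1
    ext g
    simp only [Pi.sub_apply, Pi.mul_apply, D.T_eq_linear_mul χ ε hC, hβπ, Pi.zero_apply]
    ring

theorem SG_subset_PG_of_two {G Q : Type} [Group G] [Fintype G] [Group Q] [Fintype Q]
    (π : G →* Q) (s : Q →* G) (hs : ∀ q, π (s q) = q) {z : G} (hz : π.ker = Subgroup.zpowers z)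
    (hcomm : ∀ x, x * z * x⁻¹ = z) {k : ℕ} (hk : k ≠ 0) (hord : orderOf z = 2 ^ k)
    (hQ : Odd (Nat.card Q)) (h : SG Q ⊆ PG Q) : SG G ⊆ PG G := by
  obtain ⟨ε, hεz, hε⟩ := exists_sign_of_section π s hs hz hcomm
    (hord ▸ even_two.pow_of_ne_zero hk) (by rw [hord]; positivity)
  have hεc : ∀ g, starRingEnd ℂ (ε g) = ε g := fun g => by
    rcases mul_self_eq_one_iff.mp ((sq _).symm.trans (hε g)) with h1 | h1 <;> rw [h1] <;> simp
  rintro f ⟨hperm, hdeg, hdet⟩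
  have key : IsPermChar (f ∘ s) ∧ ∃ α, IsPermChar α ∧
      f - f ∘ s ∘ π - (fun g => ε g - 1) * (α ∘ π) ∈ conjSubgroup G := by
    clear hdeg hdet
    induction hperm using Submodule.span_induction with
    | mem x hx =>
      obtain ⟨H, rfl⟩ := hx
      exact indChar_split_of_two π s hs hz hcomm hord hQ ε hεz hε H
    | zero =>
      refine ⟨Submodule.zero_mem _, 0, Submodule.zero_mem _, ?_⟩
      convert zero_mem (conjSubgroup G) using 1
      ext g; simp
    | add x y _ _ hx hy =>
      obtain ⟨hx, α, hα, hxα⟩ := hx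
      obtain ⟨hy, β, hβ, hyβ⟩ := hy
      refine ⟨Submodule.add_mem _ hx hy, α + β, Submodule.add_mem _ hα hβ, ?_⟩
      convert add_mem hxα hyβ using 1
      ext g; simp; ring
    | smul a x _ hx =>
      obtain ⟨hx, α, hα, hxα⟩ := hx
      refine ⟨Submodule.smul_mem _ a hx, a • α, Submodule.smul_mem _ a hα, ?_⟩
      convert zsmul_mem hxα a using 1
      ext g; simp; ring
  obtain ⟨hfs, α, hα, hfα⟩ := key
  have h1 : f ∘ s ∘ π ∈ conjSubgroup G :=
    comp_mem_conjSubgroup π (memP.mem_conjSubgroup_of_odd hQ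
      (h ⟨hfs, by simp [hdeg], hdet.comp s⟩))
  obtain ⟨x, hx⟩ := hα.exists_degree
  have h2 : (fun g => ε g - 1) * ((α - x • 1) ∘ π) ∈ conjSubgroup G := by
    obtain ⟨τ, hτ, hτd, e⟩ := memP.mem_conjSubgroup_of_odd hQ (h (hα.sub_degree_mem_SG hQ hx))
    refine ⟨fun g => ε g * (τ ∘ π) g - (τ ∘ π) g,
      ((hτ.comp π).linear_mul ε).sub (hτ.comp π), by simp [hτd], ?_⟩
    rw [e]
    ext g
    simp [conjFun, hεc]
    ring
  have h3 : f - (fun g => x * (ε g - 1)) ∈ conjSubgroup G := by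
    convert add_mem (add_mem hfα h1) h2 using 1
    ext g; simp; ring
  obtain ⟨τ, hτ, hτd, e⟩ := h3
  obtain ⟨y, rfl⟩ := hdet.even_of_eq ε hεz x hτ fun g => by
    have := congrFun e g
    simp only [Pi.sub_apply] at this
    linear_combination this
  have h4 : (fun g => ((y + y : ℤ) : ℂ) * (ε g - 1)) ∈ conjSubgroup G := by
    have h5 : (fun g => 2 * (ε g - 1)) ∈ conjSubgroup G :=
      ⟨fun g => ε g - 1, (isGenChar_linear ε).sub (isGenChar_one G), by simp, by
        ext g
        simp [conjFun, hεc]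
        ring⟩
    convert zsmul_mem h5 y using 1
    ext g
    simp
    ring
  refine conjSubgroup_le G ?_
  have h6 := add_mem (⟨τ, hτ, hτd, e⟩ : f - (fun g => ((y + y : ℤ) : ℂ) * (ε g - 1)) ∈ conjSubgroup G) h4
  rwa [sub_add_cancel] at h6

/-- **Proposition 2.6.** If the `p`-Sylow subgroup `N` of `G` is normal and cyclic, and
`𝒮_{G/N} ⊆ 𝒫_{G/N}`, then `𝒮_G ⊆ 𝒫_G`. -/
theorem statement11 (G : Type) [Group G] [Fintype G] (p : ℕ) (hp : p.Prime)
    (N : Sylow p G) (hN : (N : Subgroup G).Normal)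
    (hcyc : IsCyclic ↥(N : Subgroup G))
    (h : SG (G ⧸ (N : Subgroup G)) ⊆ PG (G ⧸ (N : Subgroup G))) :
    SG G ⊆ PG G := by
  have : Fact p.Prime := ⟨hp⟩
  have hndvd : ¬ p ∣ Nat.card (G ⧸ (N : Subgroup G)) := N.not_dvd_index
  obtain ⟨K, hK⟩ := Subgroup.exists_left_complement'_of_coprime N.card_coprime_index
  let e : (G ⧸ (N : Subgroup G)) ≃* K := hK.QuotientMulEquiv
  let s : (G ⧸ (N : Subgroup G)) →* G := K.subtype.comp e.toMonoidHom
  have hs : ∀ q, QuotientGroup.mk' (N : Subgroup G) (s q) = q := fun q => e.symm_apply_apply q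
  have hker : (QuotientGroup.mk' (N : Subgroup G)).ker = N := QuotientGroup.ker_mk' _
  have hsc : ∀ q, s q ^ Nat.card (G ⧸ (N : Subgroup G)) = 1 := fun q => by
    rw [← map_pow, pow_card_eq_one', map_one]
  rcases hp.eq_two_or_odd' with rfl | hodd
  · obtain ⟨z, hz⟩ := Subgroup.isCyclic_iff_exists_zpowers_eq_top (N : Subgroup G) |>.mp hcyc
    obtain ⟨k, hk⟩ := N.isPGroup'.exists_card_eq
    have hord : orderOf z = 2 ^ k := by rw [← Nat.card_zpowers, hz, hk]
    by_cases hk0 : k = 0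
    · have hN1 : (N : Subgroup G) = ⊥ := Subgroup.card_eq_one.mp (by rw [hk, hk0, pow_zero])
      obtain ⟨q, hq, hqp⟩ := Nat.exists_infinite_primes (Nat.card (G ⧸ (N : Subgroup G)) + 3)
      have hcyc' : IsCyclic (QuotientGroup.mk' (N : Subgroup G)).ker := by rwa [hker]
      exact SG_subset_PG_of_odd _ s hs hqp (hqp.odd_of_ne_two (by omega))
        (by rw [hker, hN1]; exact IsPGroup.of_bot)
        (Nat.coprime_of_lt_prime Nat.card_pos.ne' (by omega) hqp).symm hsc h
    · have heven : (Nat.card G).minFac = 2 := by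
        rw [Nat.minFac_eq_two_iff]
        exact ((dvd_pow_self 2 hk0).trans hk.symm.dvd).trans (N : Subgroup G).card_subgroup_dvd_card
      have hcomm : ∀ x, x * z * x⁻¹ = z := fun x => by
        have h1 := IsCyclic.normalizer_le_centralizer heven (P := N) hcyc
        have h2 : x ∈ Subgroup.normalizer (N : Set G) := by
          have := Subgroup.normalizer_eq_top (N : Subgroup G)
          exact this.ge (Subgroup.mem_top x)
        rw [mul_inv_eq_iff_eq_mul]
        have h3 : z ∈ (N : Subgroup G) := hz ▸ Subgroup.mem_zpowers z
        exact (Subgroup.mem_centralizer_iff.mp (h1 h2) z h3).symm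
      exact SG_subset_PG_of_two _ s hs (hker.trans hz.symm) hcomm hk0 hord
        (Nat.not_even_iff_odd.mp fun h2 => hndvd h2.two_dvd) h
  · have : IsCyclic (QuotientGroup.mk' (N : Subgroup G)).ker := by rwa [hker]
    exact SG_subset_PG_of_odd _ s hs hp hodd (by rw [hker]; exact N.isPGroup')
      ((Nat.Prime.coprime_iff_not_dvd hp).mpr hndvd).symm hsc h
end

section
/- Let G be a finite group. For every ρ ∈ 𝒮_G there exist hyperelementary subgroups H_i ≤ G, elements ρ_i ∈ 𝒮_{H_i}, and integers n_i such that ρ = Σ_i n_i Ind_{H_i}^G ρ_i. -/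
open scoped Classical

/-- A hyperelementary group: one of the form `C_n ⋊ P` with `P` a `p`-group and `p ∤ n`. -/
def IsHyperelementary (K : Type) [Group K] : Prop :=
  ∃ p : ℕ, p.Prime ∧ ∃ N P : Subgroup K, N.Normal ∧ IsCyclic ↥N ∧ IsPGroup p ↥P ∧
    ¬ p ∣ Nat.card N ∧ N ⊓ P = ⊥ ∧ N ⊔ P = ⊤

/-- A subgroup-closed reformulation of being hyperelementary: a cyclic normal `p'`-subgroup
whose quotient is a `p`-group. -/
def IsCyclicByPGroup (K : Type) [Group K] : Prop :=
  ∃ p : ℕ, p.Prime ∧ ∃ N : Subgroup K, N.Normal ∧ IsCyclic ↥N ∧ ¬ p ∣ Nat.card N ∧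
    ∀ g : K, ∃ k : ℕ, g ^ p ^ k ∈ N

theorem IsCyclicByPGroup.of_injective {L K : Type} [Group L] [Group K] [Finite K]
    (hK : IsCyclicByPGroup K) (f : L →* K) (hf : Function.Injective f) :
    IsCyclicByPGroup L := by
  obtain ⟨p, hp, N, hN, hc, hd, hg⟩ := hK
  refine ⟨p, hp, N.comap f, hN.comap f, ?_, ?_, fun g => ?_⟩
  · exact isCyclic_of_injective (f.subgroupComap N) fun a b h => by
      ext
      exact hf (congrArg Subtype.val h)
  · intro h
    refine hd (h.trans ?_)
    exact Subgroup.card_dvd_of_injective (f.subgroupComap N) fun a b h => by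
      ext
      exact hf (congrArg Subtype.val h)
  · obtain ⟨k, hk⟩ := hg (f g)
    exact ⟨k, by simpa using hk⟩

theorem IsCyclicByPGroup.isHyperelementary {K : Type} [Group K] [Finite K]
    (hK : IsCyclicByPGroup K) : IsHyperelementary K := by
  obtain ⟨p, hp, N, hN, hc, hd, hg⟩ := hK
  have : Fact p.Prime := ⟨hp⟩
  have hq : IsPGroup p (K ⧸ N) := fun q => by
    induction q using QuotientGroup.induction_on with
    | H g =>
      obtain ⟨k, hk⟩ := hg g
      exact ⟨k, by rw [← QuotientGroup.mk_pow]; exact (QuotientGroup.eq_one_iff _).2 hk⟩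
  obtain ⟨n, hn⟩ := IsPGroup.iff_card.1 hq
  have hco : Nat.Coprime (Nat.card N) N.index := by
    rw [Subgroup.index, hn]
    exact Nat.Coprime.pow_right n ((hp.coprime_iff_not_dvd.2 hd).symm)
  obtain ⟨P, hP⟩ := Subgroup.exists_right_complement'_of_coprime hco
  refine ⟨p, hp, N, P, hN, hc, fun h => ?_, hd, hP.disjoint.eq_bot, hP.sup_eq_top⟩
  obtain ⟨k, hk⟩ := hg h
  refine ⟨k, ?_⟩
  have : (h : K) ^ p ^ k ∈ N ⊓ P := ⟨hk, P.pow_mem h.2 _⟩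
  rw [hP.disjoint.eq_bot, Subgroup.mem_bot] at this
  exact Subtype.ext (by simpa using this)

/-- The permutation character of a transitive action counts fixed points in the orbit. -/
theorem indChar_stabilizer_one {K X : Type} [Group K] [Fintype K] [MulAction K X] [Fintype X]
    (x : X) (k : K) :
    indChar (MulAction.stabilizer K x) 1 k =
      ∑ y : X, if y ∈ MulAction.orbit K x ∧ k • y = y then (1 : ℂ) else 0 := by
  have hcard : (Nat.card (MulAction.stabilizer K x) : ℂ) ≠ 0 := by
    exact_mod_cast Nat.card_pos.ne'
  unfold indChar
  rw [inv_mul_eq_iff_eq_mul₀ hcard, Finset.mul_sum,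
    ← Finset.sum_fiberwise (s := Finset.univ) (g := fun g : K => g • x)]
  refine Finset.sum_congr rfl fun y _ => ?_
  by_cases hy : y ∈ MulAction.orbit K x
  · obtain ⟨g₀, rfl⟩ := hy
    beta_reduce
    have hfib : (Finset.univ.filter fun g : K => g • x = g₀ • x).card =
        Nat.card (MulAction.stabilizer K x) := by
      rw [← Fintype.card_subtype, ← Nat.card_eq_fintype_card]
      refine Nat.card_congr ⟨fun g => ⟨g₀⁻¹ * g, ?_⟩, fun g => ⟨g₀ * g, ?_⟩, ?_, ?_⟩
      · rw [MulAction.mem_stabilizer_iff, mul_smul, g.2, inv_smul_smul]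
      · rw [mul_smul, MulAction.mem_stabilizer_iff.1 g.2]
      · intro g; ext; simp
      · intro g; ext; simp
    rw [← hfib]
    have : ∀ g ∈ Finset.univ.filter (fun g : K => g • x = g₀ • x),
        (if h : g⁻¹ * k * g ∈ MulAction.stabilizer K x then
          (1 : ↥(MulAction.stabilizer K x) → ℂ) ⟨g⁻¹ * k * g, h⟩ else 0) =
        if g₀ • x ∈ MulAction.orbit K x ∧ k • g₀ • x = g₀ • x then (1 : ℂ) else 0 := by
      intro g hg
      have hg' : g • x = g₀ • x := (Finset.mem_filter.1 hg).2
      have : g⁻¹ * k * g ∈ MulAction.stabilizer K x ↔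
          g₀ • x ∈ MulAction.orbit K x ∧ k • g₀ • x = g₀ • x := by
        rw [MulAction.mem_stabilizer_iff, mul_smul, mul_smul, hg', inv_smul_eq_iff, hg']
        simp [MulAction.mem_orbit]
      by_cases h : g⁻¹ * k * g ∈ MulAction.stabilizer K x
      · rw [dif_pos h, if_pos (this.1 h)]; rfl
      · rw [dif_neg h, if_neg (fun h' => h (this.2 h'))]
    have hsum := Finset.sum_congr rfl this
    rw [Finset.sum_const, nsmul_eq_mul] at hsum
    convert hsum
  · rw [if_neg (fun h => hy h.1), mul_zero, Finset.sum_eq_zero]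
    intro g hg
    exact absurd ⟨g, (Finset.mem_filter.1 hg).2⟩ hy

theorem natCard_fixedBy {K X : Type} [Group K] [MulAction K X] [Fintype X] (k : K) :
    (Nat.card (MulAction.fixedBy X k) : ℂ) = ∑ y : X, if k • y = y then (1 : ℂ) else 0 := by
  rw [Finset.sum_boole, Nat.card_eq_fintype_card, ← Fintype.card_subtype]
  rfl

theorem indChar_one_eq_fixedBy {G : Type} [Group G] [Fintype G] (H : Subgroup G) (g : G) :
    indChar H 1 g = Nat.card (MulAction.fixedBy (G ⧸ H) g) := by
  have h := indChar_stabilizer_one (K := G) (X := G ⧸ H) ((1 : G) : G ⧸ H) g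
  rw [MulAction.stabilizer_quotient] at h
  rw [h, natCard_fixedBy]
  refine Finset.sum_congr rfl fun y _ => ?_
  simp [MulAction.orbit_eq_univ]

/-- A permutation character is the sum of the transitive ones over the orbits. -/
theorem fixedBy_eq_sum_orbits {K X : Type} [Group K] [Fintype K] [MulAction K X] [Fintype X] :
    (fun k : K => (Nat.card (MulAction.fixedBy X k) : ℂ)) =
      ∑ ω : MulAction.orbitRel.Quotient K X, indChar (MulAction.stabilizer K ω.out) 1 := by
  funext k
  rw [natCard_fixedBy, Finset.sum_apply]
  simp only [indChar_stabilizer_one]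
  rw [Finset.sum_comm]
  refine Finset.sum_congr rfl fun y _ => ?_
  have : ∀ ω : MulAction.orbitRel.Quotient K X,
      y ∈ MulAction.orbit K ω.out ↔ Quotient.mk (MulAction.orbitRel K X) y = ω := by
    intro ω
    rw [← MulAction.orbitRel_apply]
    constructor
    · intro h
      rw [← Quotient.out_eq ω]
      exact Quotient.sound h
    · rintro rfl
      exact (MulAction.orbitRel K X).symm (Quotient.mk_out (s := MulAction.orbitRel K X) y)
  simp only [this, ite_and]
  rw [Finset.sum_ite_eq]
  simp

theorem isPermChar_fixedBy {K X : Type} [Group K] [Fintype K] [MulAction K X] [Fintype X] :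
    IsPermChar fun k : K => (Nat.card (MulAction.fixedBy X k) : ℂ) := by
  rw [fixedBy_eq_sum_orbits]
  exact Submodule.sum_mem _ fun ω _ => Submodule.subset_span ⟨_, rfl⟩

theorem IsPermChar.restrict {G : Type} [Group G] [Fintype G] {f : G → ℂ} (hf : IsPermChar f)
    (K : Subgroup G) : IsPermChar fun k : K => f k := by
  unfold IsPermChar at hf
  induction hf using Submodule.span_induction with
  | mem f h =>
    obtain ⟨H, rfl⟩ := h
    have := isPermChar_fixedBy (K := K) (X := G ⧸ H)
    simp only [indChar_one_eq_fixedBy]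
    exact this
  | zero => exact Submodule.zero_mem _
  | add f g _ _ hf hg => exact Submodule.add_mem _ hf hg
  | smul n f _ hf => exact Submodule.smul_mem _ n hf

theorem HasTrivialDet.restrict {G : Type} [Group G] {f : G → ℂ} (hf : HasTrivialDet f)
    (K : Subgroup G) : HasTrivialDet fun k : K => f k := by
  obtain ⟨V, W, rfl, h⟩ := hf
  exact ⟨FDRep.of (V.ρ.comp K.subtype), FDRep.of (W.ρ.comp K.subtype), rfl, fun g => h g⟩

theorem restrict_mem_SG {G : Type} [Group G] [Fintype G] {f : G → ℂ} (hf : f ∈ SG G)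
    (K : Subgroup G) : (fun k : K => f k) ∈ SG K :=
  ⟨hf.1.restrict K, hf.2.1, hf.2.2.restrict K⟩

/-- Invariance of `f` under conjugation gives the projection formula. -/
theorem mul_indChar_one {G : Type} [Group G] [Fintype G] {f : G → ℂ}
    (hf : ∀ x g : G, f (x⁻¹ * g * x) = f g) (H : Subgroup G) :
    f * indChar H 1 = indChar H fun h : H => f h := by
  funext g
  simp only [indChar, Pi.mul_apply]
  rw [mul_left_comm, Finset.mul_sum]
  congr 1
  refine Finset.sum_congr rfl fun x _ => ?_
  split_ifs with h
  · simp [hf]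
  · simp

theorem HasTrivialDet.conj_invariant {G : Type} [Group G] {f : G → ℂ} (hf : HasTrivialDet f)
    (x g : G) : f (x⁻¹ * g * x) = f g := by
  obtain ⟨V, W, rfl, -⟩ := hf
  have h : ∀ U : FDRep ℂ G, U.character (x⁻¹ * g * x) = U.character g := fun U => by
    simpa using U.char_conj g x⁻¹
  simp [h]

/-- The local step of Solomon's induction theorem: at each element and each prime, some
hyperelementary subgroup has a permutation character nonzero modulo that prime. -/
theorem exists_not_dvd_card_fixedBy {G : Type} [Group G] [Finite G] (x : G) {p : ℕ}
    (hp : p.Prime) :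
    ∃ H : Subgroup G, IsCyclicByPGroup H ∧ ¬ p ∣ Nat.card (MulAction.fixedBy (G ⧸ H) x) := by
  have : Fact p.Prime := ⟨hp⟩
  obtain ⟨k, m, hm, hxm⟩ := Nat.exists_eq_pow_mul_and_not_dvd (orderOf_pos x).ne' p hp.ne_one
  set y := x ^ p ^ k with hy
  have hoy : orderOf y = m := by
    rw [hy, orderOf_pow_of_dvd (pow_pos hp.pos _).ne' (hxm ▸ dvd_mul_right _ _), hxm,
      Nat.mul_div_cancel_left _ (pow_pos hp.pos _)]
  set N := Subgroup.zpowers y with hN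
  set M := Subgroup.normalizer (N : Set G) with hM
  have hNM : N ≤ M := Subgroup.le_normalizer
  have hxM : x ∈ M := by
    have hc : Subgroup.centralizer (N : Set G) ≤ M := Subgroup.centralizer_le_normalizer _
    refine hc (Subgroup.mem_centralizer_iff.2 ?_)
    rintro _ ⟨j, rfl⟩
    exact (((Commute.refl x).pow_left _).zpow_left j).eq
  set N' := N.subgroupOf M with hN'
  have : N'.Normal := Subgroup.normal_in_normalizer
  let T : Sylow p (M ⧸ N') := default
  let H' : Subgroup M := T.toSubgroup.comap (QuotientGroup.mk' N')
  have hN'H' : N' ≤ H' := fun n hn => by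
    have : QuotientGroup.mk' N' n = 1 := (QuotientGroup.eq_one_iff n).2 hn
    exact Subgroup.mem_comap.2 (this ▸ T.toSubgroup.one_mem)
  have hindex : ¬ p ∣ Nat.card (M ⧸ H') := by
    have h : H'.index = T.toSubgroup.index :=
      Subgroup.index_comap_of_surjective _ (QuotientGroup.mk'_surjective N')
    have := Sylow.not_dvd_index T
    rwa [← h] at this
  let H : Subgroup G := H'.map M.subtype
  have hHM : H ≤ M := Subgroup.map_subtype_le H'
  have mem_H : ∀ g : M, (g : G) ∈ H ↔ g ∈ H' := fun g =>
    Subgroup.mem_map_iff_mem M.subtype_injective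
  have hpow : ∀ h ∈ H, ∃ j, h ^ p ^ j ∈ N := by
    rintro _ ⟨h, hh, rfl⟩
    obtain ⟨j, hj⟩ := T.isPGroup' ⟨QuotientGroup.mk' N' h, hh⟩
    refine ⟨j, ?_⟩
    have h1 : QuotientGroup.mk' N' (h ^ p ^ j) = 1 := by
      simpa using congrArg Subtype.val hj
    exact (QuotientGroup.eq_one_iff (N := N') (h ^ p ^ j)).1 h1
  have hNH : N ≤ H := fun n hn => (mem_H ⟨n, hNM hn⟩).2 (hN'H' hn)
  refine ⟨H, ⟨p, hp, N.subgroupOf H, ?_, ?_, ?_, ?_⟩, ?_⟩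
  · exact (Subgroup.normal_subgroupOf_iff_le_normalizer hNH).2 hHM
  · exact (Subgroup.subgroupOfEquivOfLe hNH).isCyclic.2 inferInstance
  · rw [Nat.card_congr (Subgroup.subgroupOfEquivOfLe hNH).toEquiv, hN, Nat.card_zpowers, hoy]
    exact hm
  · intro g
    obtain ⟨j, hj⟩ := hpow g g.2
    exact ⟨j, by simpa [Subgroup.mem_subgroupOf] using hj⟩
  -- an element moving `x` into `H` normalises `N`
  have hmem : ∀ g : G, g⁻¹ * x * g ∈ H → g ∈ M := by
    intro g hg
    have hconj : (g⁻¹ * x * g) ^ p ^ k = g⁻¹ * y * g := by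
      simpa using conj_pow (i := p ^ k) (a := g⁻¹) (b := x)
    have hyH : g⁻¹ * y * g ∈ H := hconj ▸ H.pow_mem hg _
    have hord : orderOf (g⁻¹ * y * g) = m := by
      rw [← hoy]
      have := (MulAut.conj g⁻¹).orderOf_eq y
      simpa [MulAut.conj_apply] using this
    have hyN : g⁻¹ * y * g ∈ N := by
      obtain ⟨j, hj⟩ := hpow _ hyH
      obtain ⟨i, hi⟩ := exists_pow_eq_self_of_coprime (x := g⁻¹ * y * g) (n := p ^ j)
        (by rw [hord]; exact Nat.Coprime.pow_left j (hp.coprime_iff_not_dvd.2 hm))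
      rw [← hi]
      exact N.pow_mem hj i
    have hinv : g⁻¹ ∈ M := by
      refine Subgroup.mem_normalizer_fintype ?_
      rintro _ ⟨j, rfl⟩
      have := N.zpow_mem hyN j
      have hz : (g⁻¹ * y * g) ^ j = g⁻¹ * y ^ j * g := by
        simpa using conj_zpow (i := j) (a := g⁻¹) (b := y)
      rw [hz] at this
      simpa using this
    simpa using M.inv_mem hinv
  let xM : M := ⟨x, hxM⟩
  let φ : M ⧸ H' → G ⧸ H := Quotient.map' (fun g : M => (g : G)) fun a b hab => by
    rw [QuotientGroup.leftRel_apply] at hab ⊢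
    exact (mem_H (a⁻¹ * b)).2 hab
  have hφ : Function.Injective φ := by
    intro a b
    induction a using QuotientGroup.induction_on
    induction b using QuotientGroup.induction_on
    intro hab
    exact QuotientGroup.eq.2 ((mem_H _).1 (QuotientGroup.eq.1 hab))
  have hφx : ∀ a, φ (xM • a) = x • φ a := by
    intro a
    induction a using QuotientGroup.induction_on
    rfl
  have hcard : Nat.card (MulAction.fixedBy (G ⧸ H) x) =
      Nat.card (MulAction.fixedBy (M ⧸ H') xM) := by
    symm
    refine Nat.card_congr (Equiv.ofBijective
      (fun a => ⟨φ a.1, ?_⟩) ⟨fun a b hab => ?_, ?_⟩)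
    · rw [MulAction.mem_fixedBy, ← hφx, a.2]
    · exact Subtype.ext (hφ (congrArg Subtype.val hab))
    · rintro ⟨b, hb⟩
      induction b using QuotientGroup.induction_on with
      | H g =>
      have hg : g⁻¹ * x * g ∈ H := by
        have : ((x * g : G) : G ⧸ H) = (g : G ⧸ H) := hb
        have := QuotientGroup.eq.1 this.symm
        rwa [← mul_assoc] at this
      refine ⟨⟨((⟨g, hmem g hg⟩ : M) : M ⧸ H'), ?_⟩, rfl⟩
      apply hφ
      rw [hφx]
      exact hb
  rw [hcard]
  let σ : Function.End (M ⧸ H') := MulAction.toEndHom xM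
  have hσ : σ ^ p ^ k = 1 := by
    have : σ ^ p ^ k = MulAction.toEndHom (xM ^ p ^ k) :=
      (map_pow MulAction.toEndHom xM (p ^ k)).symm
    rw [this]
    funext a
    induction a using QuotientGroup.induction_on with
    | H g =>
    change ((xM ^ p ^ k * g : M) : M ⧸ H') = (g : M ⧸ H')
    refine (QuotientGroup.eq.2 ?_).symm
    have hxN : xM ^ p ^ k ∈ N' := Subgroup.mem_zpowers y
    have := hN'H' (Subgroup.Normal.conj_mem' inferInstance _ hxN g)
    rwa [mul_assoc] at this
  have := Fintype.ofFinite (M ⧸ H')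
  have hmod := Equiv.Perm.card_fixedPoints_modEq hσ
  simp only [Fintype.card_eq_nat_card] at hmod
  intro hdvd
  exact hindex ((Nat.modEq_zero_iff_dvd).1 (hmod.trans ((Nat.modEq_zero_iff_dvd).2 hdvd)))

/-- The characters of finite `G`-sets all of whose point stabilisers are cyclic-by-`p`. -/
def hyperPermChars (G : Type) [Group G] : Set (G → ℤ) :=
  {f | ∃ (X : Type) (_ : MulAction G X) (_ : Finite X),
    (∀ x : X, IsCyclicByPGroup (MulAction.stabilizer G x)) ∧
      f = fun g => (Nat.card (MulAction.fixedBy X g) : ℤ)}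

theorem mul_mem_hyperPermChars {G : Type} [Group G] [Finite G] {f h : G → ℤ}
    (hf : f ∈ hyperPermChars G) (hh : h ∈ hyperPermChars G) : f * h ∈ hyperPermChars G := by
  obtain ⟨X, _, _, hX, rfl⟩ := hf
  obtain ⟨Y, _, _, -, rfl⟩ := hh
  refine ⟨X × Y, inferInstance, inferInstance, fun z => ?_, ?_⟩
  · have hle : MulAction.stabilizer G z ≤ MulAction.stabilizer G z.1 := fun g hg =>
      congrArg Prod.fst hg
    exact (hX z.1).of_injective (Subgroup.inclusion hle) (Subgroup.inclusion_injective hle)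
  · funext g
    rw [Pi.mul_apply, ← Nat.cast_mul, ← Nat.card_prod]
    congr 1
    refine Nat.card_congr ⟨fun z => ⟨(z.1, z.2), Prod.ext z.1.2 z.2.2⟩,
      fun z => (⟨z.1.1, congrArg Prod.fst z.2⟩, ⟨z.1.2, congrArg Prod.snd z.2⟩),
      fun _ => rfl, fun _ => rfl⟩

theorem mul_mem_closure_hyperPermChars {G : Type} [Group G] [Finite G] {f h : G → ℤ}
    (hf : f ∈ AddSubgroup.closure (hyperPermChars G))
    (hh : h ∈ AddSubgroup.closure (hyperPermChars G)) :
    f * h ∈ AddSubgroup.closure (hyperPermChars G) := by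
  induction hf using AddSubgroup.closure_induction with
  | mem f hf =>
    induction hh using AddSubgroup.closure_induction with
    | mem h hh => exact AddSubgroup.subset_closure (mul_mem_hyperPermChars hf hh)
    | zero => simp
    | add a b _ _ ha hb => rw [mul_add]; exact AddSubgroup.add_mem _ ha hb
    | neg a _ ha => rw [mul_neg]; exact AddSubgroup.neg_mem _ ha
  | zero => simp
  | add a b _ _ ha hb => rw [add_mul]; exact AddSubgroup.add_mem _ ha hb
  | neg a _ ha => rw [neg_mul]; exact AddSubgroup.neg_mem _ ha

theorem exists_mem_closure_eval_one {G : Type} [Group G] [Finite G] (x : G) :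
    ∃ f ∈ AddSubgroup.closure (hyperPermChars G), f x = 1 := by
  let E := (AddSubgroup.closure (hyperPermChars G)).map (Pi.evalAddMonoidHom (fun _ : G => ℤ) x)
  obtain ⟨a, ha⟩ := Int.subgroup_cyclic E
  have hunit : a.natAbs = 1 := by
    by_contra hne
    obtain ⟨p, hp, hpa⟩ := Nat.exists_prime_and_dvd hne
    obtain ⟨H, hH, hd⟩ := exists_not_dvd_card_fixedBy x hp
    apply hd
    have hE : (Nat.card (MulAction.fixedBy (G ⧸ H) x) : ℤ) ∈ E := by
      refine ⟨fun g => (Nat.card (MulAction.fixedBy (G ⧸ H) g) : ℤ),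
        AddSubgroup.subset_closure ⟨G ⧸ H, inferInstance, inferInstance, fun q => ?_, rfl⟩, rfl⟩
      induction q using QuotientGroup.induction_on with
      | H g =>
      have hs : ∀ t ∈ MulAction.stabilizer G (g : G ⧸ H), g⁻¹ * t * g ∈ H := by
        intro t ht
        have h1 : ((t * g : G) : G ⧸ H) = (g : G ⧸ H) := ht
        have h2 := QuotientGroup.eq.1 h1.symm
        rwa [← mul_assoc] at h2
      refine hH.of_injective
        { toFun := fun t => ⟨g⁻¹ * t * g, hs t t.2⟩
          map_one' := by ext; simp
          map_mul' := fun a b => by ext; simp [mul_assoc] } ?_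
      intro a b hab
      have := congrArg Subtype.val hab
      ext
      simpa using this
    rw [ha, AddSubgroup.mem_closure_singleton] at hE
    obtain ⟨n, hn⟩ := hE
    have : (p : ℤ) ∣ Nat.card (MulAction.fixedBy (G ⧸ H) x) := by
      rw [← hn, smul_eq_mul]
      exact dvd_mul_of_dvd_right (Int.natCast_dvd.2 hpa) n
    exact_mod_cast this
  have h1 : (1 : ℤ) ∈ E := by
    rw [ha, AddSubgroup.mem_closure_singleton]
    exact ⟨a, by rw [smul_eq_mul, ← Int.natAbs_mul_self, hunit]; rfl⟩
  obtain ⟨f, hf, hfx⟩ := h1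
  exact ⟨f, hf, hfx⟩

theorem one_mem_closure_hyperPermChars {G : Type} [Group G] [Fintype G] :
    (1 : G → ℤ) ∈ AddSubgroup.closure (hyperPermChars G) := by
  choose F hF hF1 using exists_mem_closure_eval_one (G := G)
  have key : ∀ s : Finset G,
      1 - ∏ x ∈ s, (1 - F x) ∈ AddSubgroup.closure (hyperPermChars G) := by
    intro s
    induction s using Finset.induction_on with
    | empty => simp
    | insert a s ha ih =>
      rw [Finset.prod_insert ha]
      have : 1 - (1 - F a) * ∏ x ∈ s, (1 - F x) =
          F a + (1 - ∏ x ∈ s, (1 - F x)) - F a * (1 - ∏ x ∈ s, (1 - F x)) := by ring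
      rw [this]
      exact AddSubgroup.sub_mem _ (AddSubgroup.add_mem _ (hF a) ih)
        (mul_mem_closure_hyperPermChars (hF a) ih)
  have hzero : ∏ x : G, (1 - F x) = 0 := by
    funext g
    rw [Finset.prod_apply]
    exact Finset.prod_eq_zero (Finset.mem_univ g) (by simp [hF1])
  simpa [hzero] using key Finset.univ

/-- **Solomon's induction theorem.** -/
theorem one_mem_span_indChar_hyperelementary (G : Type) [Group G] [Fintype G] :
    (1 : G → ℂ) ∈ Submodule.span ℤ
      {f : G → ℂ | ∃ H : Subgroup G, IsHyperelementary H ∧ f = indChar H 1} := by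
  have key : ∀ f ∈ AddSubgroup.closure (hyperPermChars G), (fun g => (f g : ℂ)) ∈
      Submodule.span ℤ
        {f : G → ℂ | ∃ H : Subgroup G, IsHyperelementary H ∧ f = indChar H 1} := by
    intro f hf
    induction hf using AddSubgroup.closure_induction with
    | mem f hf =>
      obtain ⟨X, _, _, hX, rfl⟩ := hf
      have := Fintype.ofFinite X
      have h := fixedBy_eq_sum_orbits (K := G) (X := X)
      simp only [Int.cast_natCast]
      rw [h]
      exact Submodule.sum_mem _ fun ω _ =>
        Submodule.subset_span ⟨_, (hX _).isHyperelementary, rfl⟩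
    | zero =>
      simp only [Pi.zero_apply, Int.cast_zero]
      exact Submodule.zero_mem _
    | add a b _ _ ha hb =>
      simp only [Pi.add_apply, Int.cast_add]
      exact Submodule.add_mem _ ha hb
    | neg a _ ha =>
      simp only [Pi.neg_apply, Int.cast_neg]
      exact Submodule.neg_mem _ ha
  have h := key 1 one_mem_closure_hyperPermChars
  simp only [Pi.one_apply, Int.cast_one] at h
  exact h

/-- **Lemma 2.7.** For every `ρ ∈ 𝒮_G` there are hyperelementary subgroups `H_i ≤ G`,
elements `ρ_i ∈ 𝒮_{H_i}` and integers `n_i` such that `ρ = Σ_i n_i Ind_{H_i}^G ρ_i`. -/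
theorem statement12 (G : Type) [Group G] [Fintype G] (ρ : G → ℂ) (hρ : ρ ∈ SG G) :
    ∃ (ι : Type) (s : Finset ι) (H : ι → Subgroup G) (ρ' : ∀ i, ↥(H i) → ℂ) (n : ι → ℤ),
      (∀ i ∈ s, IsHyperelementary ↥(H i) ∧ ρ' i ∈ SG ↥(H i)) ∧
      ρ = ∑ i ∈ s, n i • indChar (H i) (ρ' i) := by
  obtain ⟨m, n, F, hsum⟩ :=
    Submodule.mem_span_set'.1 (one_mem_span_indChar_hyperelementary G)
  choose H hH hF using fun i => (F i).2
  refine ⟨Fin m, Finset.univ, H, fun i h => ρ h, n,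
    fun i _ => ⟨hH i, restrict_mem_SG hρ (H i)⟩, ?_⟩
  calc ρ = ρ * ∑ i, n i • (F i : G → ℂ) := by rw [hsum, mul_one]
    _ = ∑ i, n i • indChar (H i) (fun h : H i => ρ h) := by
      rw [Finset.mul_sum]
      refine Finset.sum_congr rfl fun i _ => ?_
      rw [hF i, mul_smul_comm, mul_indChar_one hρ.2.2.conj_invariant]
end
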